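/- Convergence rate of the Schmüdgen SOS hierarchy for the discrete Gromov-Wasserstein problem: set K = max_{i,k∈[m], j,l∈[n]} |L_{ij,kl}|. There exist constants B > 0 and C > 0, depending only on m and n, such that for every integer r ≥ 4mn: 0 ≤ DGW − lb(L,T(Π(μ,ν)))_r ≤ (C/r²)·(K − DGW + 3√(mn)·K·B) + (√C/r)·3√(mn)·K·B. In particular, lb(L,T(Π(μ,ν)))_r converges to DGW at rate O(1/r) as r → ∞. -/

import Mathlib

open MvPolynomial

/-- The Riesz functional associated to a moment sequence `z`. -/
noncomputable def riesz {σ : Type*} (z : (σ →₀ ℕ) → ℝ) (p : MvPolynomial σ ℝ) : ℝ :=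
  ∑ α ∈ p.support, MvPolynomial.coeff α p * z α

/-- The total degree (length) of a multi-index. -/
def mdeg {σ : Type*} (α : σ →₀ ℕ) : ℕ := α.sum fun _ e => e

/-- Positive semidefiniteness of the truncated localizing matrix `M_t(g z)`:
the associated quadratic form is nonnegative on coefficient vectors of
polynomials of degree at most `t`. -/
def locPSD {σ : Type*} (z : (σ →₀ ℕ) → ℝ) (g : MvPolynomial σ ℝ) (t : ℕ) : Prop :=
  ∀ p : MvPolynomial σ ℝ, p.totalDegree ≤ t → 0 ≤ riesz z (g * p ^ 2)

/-- Vanishing of the truncated localizing matrix `M_t(g z)`: all entries are zero. -/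
def locZero {σ : Type*} (z : (σ →₀ ℕ) → ℝ) (g : MvPolynomial σ ℝ) (t : ℕ) : Prop :=
  ∀ α β : σ →₀ ℕ, mdeg α ≤ t → mdeg β ≤ t →
    riesz z (g * monomial α 1 * monomial β 1) = 0

/-- The row-marginal polynomial `r_i(π) = ∑_j π_{ij} - μ_i`. -/
noncomputable def rowPoly (a b : ℕ) (μ : Fin a → ℝ) (i : Fin a) :
    MvPolynomial (Fin a × Fin b) ℝ :=
  (∑ j, X (i, j)) - C (μ i)

/-- The column-marginal polynomial `c_j(π) = ∑_i π_{ij} - ν_j`. -/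
noncomputable def colPoly (a b : ℕ) (ν : Fin b → ℝ) (j : Fin b) :
    MvPolynomial (Fin a × Fin b) ℝ :=
  (∑ i, X (i, j)) - C (ν j)

/-- The monomial `e_I = ∏_{(i,j) ∈ I} π_{ij}`. -/
noncomputable def eI {a b : ℕ} (I : Finset (Fin a × Fin b)) : MvPolynomial (Fin a × Fin b) ℝ :=
  ∏ q ∈ I, X q

/-- A probability vector: nonnegative entries summing to 1. -/
def IsProbVec {a : ℕ} (μ : Fin a → ℝ) : Prop := (∀ i, 0 ≤ μ i) ∧ ∑ i, μ i = 1

/-- Feasibility for the level-`r` Schmüdgen moment relaxation (S-DGW-r). -/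
def SFeas (a b r : ℕ) (μ : Fin a → ℝ) (ν : Fin b → ℝ)
    (z : ((Fin a × Fin b) →₀ ℕ) → ℝ) : Prop :=
  z 0 = 1 ∧
  (∀ I : Finset (Fin a × Fin b), I.card ≤ 2 * r → locPSD z (eI I) (r - (I.card + 1) / 2)) ∧
  (∀ i, locZero z (rowPoly a b μ i) (r - 1)) ∧
  (∀ j, locZero z (colPoly a b ν j) (r - 1)) ∧
  (∀ i₁ i₂ : Fin a, ∀ j : Fin b, locZero z (rowPoly a b μ i₁ * X (i₂, j)) (r - 1)) ∧
  (∀ j₁ j₂ : Fin b, ∀ i : Fin a, locZero z (colPoly a b ν j₁ * X (i, j₂)) (r - 1))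

/-- The objective of the Schmüdgen moment relaxation. -/
noncomputable def objS (a b : ℕ) (L : Fin a → Fin b → Fin a → Fin b → ℝ)
    (z : ((Fin a × Fin b) →₀ ℕ) → ℝ) : ℝ :=
  ∑ i, ∑ j, ∑ k, ∑ l, L i j k l * z (Finsupp.single (i, j) 1 + Finsupp.single (k, l) 1)

/-- The optimal value of the level-`r` Schmüdgen moment relaxation. -/
noncomputable def valS (a b r : ℕ) (μ : Fin a → ℝ) (ν : Fin b → ℝ)
    (L : Fin a → Fin b → Fin a → Fin b → ℝ) : ℝ :=
  sInf {v : ℝ | ∃ z, SFeas a b r μ ν z ∧ v = objS a b L z}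

/-- A polynomial is SOS if it is a finite sum of squares of polynomials. -/
def IsSOS {σ : Type*} (p : MvPolynomial σ ℝ) : Prop :=
  ∃ (k : ℕ) (q : Fin k → MvPolynomial σ ℝ), p = ∑ i, q i ^ 2

/-- Membership in the truncated preordering `T(Π(μ,ν))_{2r}`. -/
def InPreT (a b r : ℕ) (μ : Fin a → ℝ) (ν : Fin b → ℝ)
    (f : MvPolynomial (Fin a × Fin b) ℝ) : Prop :=
  ∃ (σ0 : MvPolynomial (Fin a × Fin b) ℝ)
    (σI : Finset (Fin a × Fin b) → MvPolynomial (Fin a × Fin b) ℝ)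
    (lam : Fin a → MvPolynomial (Fin a × Fin b) ℝ)
    (th : Fin b → MvPolynomial (Fin a × Fin b) ℝ),
    IsSOS σ0 ∧ σ0.totalDegree ≤ 2 * r ∧
    (∀ I, IsSOS (σI I) ∧ (eI I * σI I).totalDegree ≤ 2 * r) ∧
    (∀ i, (lam i).totalDegree ≤ 2 * r - 1) ∧
    (∀ j, (th j).totalDegree ≤ 2 * r - 1) ∧
    f = σ0 + ∑ I : Finset (Fin a × Fin b), eI I * σI I
        + ∑ i, lam i * rowPoly a b μ i + ∑ j, th j * colPoly a b ν j

/-- The GW cost as a quadratic polynomial in the variables `π_{ij}`. -/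
noncomputable def Lpoly (a b : ℕ) (L : Fin a → Fin b → Fin a → Fin b → ℝ) :
    MvPolynomial (Fin a × Fin b) ℝ :=
  ∑ i, ∑ j, ∑ k, ∑ l, C (L i j k l) * X (i, j) * X (k, l)

/-- The Schmüdgen SOS lower bound `lb(L, T(Π(μ,ν)))_r`. -/
noncomputable def lbS (a b r : ℕ) (μ : Fin a → ℝ) (ν : Fin b → ℝ)
    (L : Fin a → Fin b → Fin a → Fin b → ℝ) : ℝ :=
  sSup {c : ℝ | InPreT a b r μ ν (Lpoly a b L - C c)}

/-- The transport polytope `Π(μ,ν)`. -/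
def transportPolytope (a b : ℕ) (μ : Fin a → ℝ) (ν : Fin b → ℝ) : Set (Fin a → Fin b → ℝ) :=
  {π | (∀ i j, 0 ≤ π i j) ∧ (∀ i, ∑ j, π i j = μ i) ∧ (∀ j, ∑ i, π i j = ν j)}

/-- The quadratic Gromov-Wasserstein objective `L(π)`. -/
noncomputable def Lquad (a b : ℕ) (L : Fin a → Fin b → Fin a → Fin b → ℝ)
    (π : Fin a → Fin b → ℝ) : ℝ :=
  ∑ i, ∑ j, ∑ k, ∑ l, L i j k l * π i j * π k l

/-- The optimal value of the discrete Gromov-Wasserstein problem (DGW). -/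
noncomputable def DGW (a b : ℕ) (μ : Fin a → ℝ) (ν : Fin b → ℝ)
    (L : Fin a → Fin b → Fin a → Fin b → ℝ) : ℝ :=
  sInf {v : ℝ | ∃ π ∈ transportPolytope a b μ ν, v = Lquad a b L π}

/-- The maximal absolute value `K = max |L_{ij,kl}|` of the cost tensor. -/
noncomputable def Kmax (a b : ℕ) (L : Fin a → Fin b → Fin a → Fin b → ℝ) : ℝ :=
  sSup {v : ℝ | ∃ i j k l, v = |L i j k l|}

theorem sum_range_cos_mul_eq_zero (P : ℕ) (a : ℤ) (ha : ¬ (P : ℤ) ∣ a) :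
    ∑ s ∈ Finset.range P, Real.cos (a * (s * (2 * Real.pi / P))) = 0 := by
  rcases Nat.eq_zero_or_pos P with rfl | hP
  · simp
  have hζ := Complex.isPrimitiveRoot_exp P hP.ne'
  set ζ := Complex.exp (2 * Real.pi * Complex.I / P) with hζdef
  have hne : ζ ^ a ≠ 1 := fun h => ha ((hζ.zpow_eq_one_iff_dvd a).1 h)
  have hone : (ζ ^ a) ^ P = 1 := by
    rw [← zpow_natCast, ← zpow_mul, mul_comm, zpow_mul, zpow_natCast, hζ.pow_eq_one, one_zpow]
  have hsum : ∑ s ∈ Finset.range P, (ζ ^ a) ^ s = 0 := by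
    rw [geom_sum_eq hne, hone, sub_self, zero_div]
  have hre := congrArg Complex.re hsum
  rw [Complex.re_sum, Complex.zero_re] at hre
  rw [← hre]
  refine Finset.sum_congr rfl fun s _ => ?_
  rw [hζdef, ← Complex.exp_int_mul, ← Complex.exp_nat_mul]
  have : (s : ℂ) * ((a : ℂ) * (2 * Real.pi * Complex.I / P))
      = ((a * (s * (2 * Real.pi / P)) : ℝ) : ℂ) * Complex.I := by
    push_cast
    ring
  rw [this, Complex.exp_ofReal_mul_I_re]

theorem sum_range_cos_mul (P : ℕ) (a : ℤ) (ha : |a| < P) :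
    ∑ s ∈ Finset.range P, Real.cos (a * (s * (2 * Real.pi / P))) = if a = 0 then (P : ℝ) else 0 := by
  split_ifs with h
  · simp [h]
  · refine sum_range_cos_mul_eq_zero P a fun hd => h ?_
    exact Int.eq_zero_of_abs_lt_dvd hd ha

theorem squares_eq_sum_cos (N : ℕ) (q : ℕ → ℝ) (φ θ : ℝ) :
    (∑ k ∈ Finset.range N, q k * Real.cos ((k + 1) * φ) * Real.cos ((k + 1) * θ)) ^ 2
      + (∑ k ∈ Finset.range N, q k * Real.sin ((k + 1) * φ) * Real.cos ((k + 1) * θ)) ^ 2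
      + ((∑ k ∈ Finset.range N, q k * Real.cos ((k + 1) * φ) * Real.sin ((k + 1) * θ)) ^ 2
      + (∑ k ∈ Finset.range N, q k * Real.sin ((k + 1) * φ) * Real.sin ((k + 1) * θ)) ^ 2)
    = ∑ k ∈ Finset.range N, ∑ l ∈ Finset.range N,
        q k * q l * (Real.cos ((k - l : ℝ) * φ) * Real.cos ((k - l : ℝ) * θ)) := by
  simp only [sq, Finset.sum_mul_sum, ← Finset.sum_add_distrib]
  refine Finset.sum_congr rfl fun k _ => Finset.sum_congr rfl fun l _ => ?_
  have h : ∀ x : ℝ, Real.cos ((k - l : ℝ) * x)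
      = Real.cos ((k + 1) * x) * Real.cos ((l + 1) * x)
        + Real.sin ((k + 1) * x) * Real.sin ((l + 1) * x) := fun x => by
    rw [← Real.cos_sub]
    ring_nf
  rw [h, h]
  ring

theorem sum_range_sum_range_ite_add (N j : ℕ) (g : ℕ → ℕ → ℝ) :
    ∑ k ∈ Finset.range N, ∑ l ∈ Finset.range N, (if k + j = l then g k l else 0)
      = ∑ k ∈ Finset.range (N - j), g k (k + j) := by
  have h : ∀ k ∈ Finset.range N, ∑ l ∈ Finset.range N, (if k + j = l then g k l else 0)
      = if k < N - j then g k (k + j) else 0 := fun k _ => by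
    rw [Finset.sum_ite_eq]
    simp only [Finset.mem_range]
    exact if_congr (by omega) rfl rfl
  rw [Finset.sum_congr rfl h, ← Finset.sum_filter]
  refine Finset.sum_congr ?_ fun _ _ => rfl
  ext k
  simp only [Finset.mem_filter, Finset.mem_range]
  omega

theorem sum_cos_mul_sum_cos (N P j : ℕ) (hP : N + j ≤ P) (q : ℕ → ℝ) (θ : ℝ) :
    ∑ s ∈ Finset.range P, Real.cos (j * (s * (2 * Real.pi / P)))
        * (∑ k ∈ Finset.range N, ∑ l ∈ Finset.range N,
          q k * q l * (Real.cos ((k - l : ℝ) * (s * (2 * Real.pi / P)))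
            * Real.cos ((k - l : ℝ) * θ)))
      = P * Real.cos (j * θ) * ∑ k ∈ Finset.range (N - j), q k * q (k + j) := by
  have key : ∀ k ∈ Finset.range N, ∀ l ∈ Finset.range N,
      ∑ s ∈ Finset.range P, Real.cos (j * (s * (2 * Real.pi / P)))
        * Real.cos ((k - l : ℝ) * (s * (2 * Real.pi / P)))
      = (P / 2 : ℝ) * ((if k + j = l then 1 else 0) + (if l + j = k then 1 else 0)) := by
    intro k hk l hl
    rw [Finset.mem_range] at hk hl
    have h1 := sum_range_cos_mul P ((j : ℤ) + (k - l)) (by rw [abs_lt]; omega)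
    have h2 := sum_range_cos_mul P ((j : ℤ) - (k - l)) (by rw [abs_lt]; omega)
    have e : ∀ s ∈ Finset.range P, Real.cos (j * (s * (2 * Real.pi / P)))
        * Real.cos ((k - l : ℝ) * (s * (2 * Real.pi / P)))
        = (Real.cos (((j : ℤ) + (k - l) : ℤ) * (s * (2 * Real.pi / P)))
          + Real.cos (((j : ℤ) - (k - l) : ℤ) * (s * (2 * Real.pi / P)))) / 2 := fun s _ => by
      push_cast
      rw [add_mul, sub_mul (j : ℝ), Real.cos_add, Real.cos_sub]
      ring
    rw [Finset.sum_congr rfl e, ← Finset.sum_div, Finset.sum_add_distrib, h1, h2]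
    have i1 : (if (j : ℤ) + (k - l) = 0 then (P : ℝ) else 0) = P * if k + j = l then 1 else 0 := by
      rw [mul_ite, mul_one, mul_zero]
      exact if_congr (by omega) rfl rfl
    have i2 : (if (j : ℤ) - (k - l) = 0 then (P : ℝ) else 0) = P * if l + j = k then 1 else 0 := by
      rw [mul_ite, mul_one, mul_zero]
      exact if_congr (by omega) rfl rfl
    rw [i1, i2]
    ring
  have step : ∑ s ∈ Finset.range P, Real.cos (j * (s * (2 * Real.pi / P)))
        * (∑ k ∈ Finset.range N, ∑ l ∈ Finset.range N,
          q k * q l * (Real.cos ((k - l : ℝ) * (s * (2 * Real.pi / P)))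
            * Real.cos ((k - l : ℝ) * θ)))
      = ∑ k ∈ Finset.range N, ∑ l ∈ Finset.range N,
          q k * q l * Real.cos ((k - l : ℝ) * θ) *
          ∑ s ∈ Finset.range P, Real.cos (j * (s * (2 * Real.pi / P)))
            * Real.cos ((k - l : ℝ) * (s * (2 * Real.pi / P))) := by
    simp only [Finset.mul_sum]
    rw [Finset.sum_comm]
    refine Finset.sum_congr rfl fun k _ => ?_
    rw [Finset.sum_comm]
    refine Finset.sum_congr rfl fun l _ => Finset.sum_congr rfl fun s _ => ?_
    ring
  have split : ∀ k ∈ Finset.range N, ∀ l ∈ Finset.range N,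
      q k * q l * Real.cos ((k - l : ℝ) * θ) *
          ∑ s ∈ Finset.range P, Real.cos (j * (s * (2 * Real.pi / P)))
            * Real.cos ((k - l : ℝ) * (s * (2 * Real.pi / P)))
      = (P / 2 : ℝ) * Real.cos (j * θ) * (if k + j = l then q k * q l else 0)
        + (P / 2 : ℝ) * Real.cos (j * θ) * (if l + j = k then q l * q k else 0) := by
    intro k hk l hl
    rw [key k hk l hl]
    have c1 : k + j = l → Real.cos ((k - l : ℝ) * θ) = Real.cos (j * θ) := by
      rintro rfl
      rw [← Real.cos_neg]
      push_cast
      ring_nf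
    have c2 : l + j = k → Real.cos ((k - l : ℝ) * θ) = Real.cos (j * θ) := by
      rintro rfl
      push_cast
      ring_nf
    by_cases d1 : k + j = l <;> by_cases d2 : l + j = k
    · simp only [d1, d2, if_true, c1 d1]; ring
    · simp only [d1, d2, if_true, if_false, c1 d1]; ring
    · simp only [d1, d2, if_true, if_false, c2 d2]; ring
    · simp only [d1, d2, if_false]; ring
  rw [step, Finset.sum_congr rfl fun k hk => Finset.sum_congr rfl fun l hl => split k hk l hl]
  simp only [Finset.sum_add_distrib, ← Finset.mul_sum]
  rw [sum_range_sum_range_ite_add N j fun k l => q k * q l, Finset.sum_comm,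
    sum_range_sum_range_ite_add N j fun k l => q k * q l]
  ring

theorem sum_range_sin_sq (N : ℕ) (hN : 0 < N) :
    ∑ k ∈ Finset.range N, Real.sin ((k + 1) * (Real.pi / (N + 1))) ^ 2 = (N + 1) / 2 := by
  have h := sum_range_cos_mul (N + 1) 1 (by rw [abs_one]; omega)
  rw [if_neg one_ne_zero, Finset.sum_range_succ'] at h
  have e : ∀ k ∈ Finset.range N, Real.sin ((k + 1) * (Real.pi / (N + 1))) ^ 2
      = 1 / 2 - Real.cos ((1 : ℤ) * ((k + 1 : ℕ) * (2 * Real.pi / (N + 1 : ℕ)))) / 2 := fun k _ => by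
    rw [Real.sin_sq_eq_half_sub]
    push_cast
    ring_nf
  rw [Finset.sum_congr rfl e, Finset.sum_sub_distrib, ← Finset.sum_div, ← Finset.sum_div]
  simp only [Nat.cast_zero, zero_mul, mul_zero, Real.cos_zero] at h
  rw [eq_neg_of_add_eq_zero_left h]
  simp
  ring

theorem sum_range_sin_mul_sin_succ (N : ℕ) (hN : 0 < N) :
    ∑ k ∈ Finset.range (N - 1), Real.sin ((k + 1) * (Real.pi / (N + 1)))
        * Real.sin (((k + 1 : ℕ) + 1) * (Real.pi / (N + 1)))
      = Real.cos (Real.pi / (N + 1)) * ((N + 1) / 2) := by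
  obtain ⟨M, rfl⟩ : ∃ M, N = M + 1 := ⟨N - 1, by omega⟩
  rw [Nat.add_sub_cancel, ← sum_range_sin_sq (M + 1) hN]
  set h : ℝ := Real.pi / ((M + 1 : ℕ) + 1) with hh
  have hend : Real.sin (((M + 1 : ℕ) + 1) * h) = 0 := by
    rw [hh, mul_div_cancel₀ _ (by positivity), Real.sin_pi]
  have e : ∀ k : ℕ, 2 * (Real.cos h * Real.sin ((k + 1) * h) ^ 2)
      = Real.sin ((k + 1) * h) * Real.sin (((k + 1 : ℕ) + 1) * h)
        + Real.sin (k * h) * Real.sin ((k + 1) * h) := fun k => by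
    have a1 : Real.sin (((k + 1 : ℕ) + 1) * h)
        = Real.sin ((k + 1) * h) * Real.cos h + Real.cos ((k + 1) * h) * Real.sin h := by
      rw [← Real.sin_add]
      push_cast
      ring_nf
    have a2 : Real.sin (k * h)
        = Real.sin ((k + 1) * h) * Real.cos h - Real.cos ((k + 1) * h) * Real.sin h := by
      rw [← Real.sin_sub]
      ring_nf
    rw [a1, a2]
    ring
  have s := Finset.sum_congr rfl fun k (_ : k ∈ Finset.range (M + 1)) => e k
  rw [← Finset.mul_sum, ← Finset.mul_sum, Finset.sum_add_distrib,
    Finset.sum_range_succ fun k : ℕ => Real.sin ((k + 1) * h) * Real.sin (((k + 1 : ℕ) + 1) * h),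
    Finset.sum_range_succ' fun k : ℕ => Real.sin (k * h) * Real.sin ((k + 1) * h)] at s
  rw [hend] at s
  push_cast at s ⊢
  simp only [zero_mul, mul_zero, Real.sin_zero, add_zero] at s
  linarith

theorem sum_range_sin_mul_sin_succ_succ (N : ℕ) (hN : 2 ≤ N) :
    ∑ k ∈ Finset.range (N - 2), Real.sin ((k + 1) * (Real.pi / (N + 1)))
        * Real.sin (((k + 2 : ℕ) + 1) * (Real.pi / (N + 1)))
      = (N + 1) / 2 - N * Real.sin (Real.pi / (N + 1)) ^ 2 := by
  obtain ⟨M, rfl⟩ : ∃ M, N = M + 2 := ⟨N - 2, by omega⟩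
  rw [Nat.add_sub_cancel, ← sum_range_sin_sq (M + 2) (by omega)]
  set h : ℝ := Real.pi / ((M + 2 : ℕ) + 1) with hh
  have hend : Real.sin (((M + 1 : ℕ) + 1) * h) = Real.sin h := by
    have : ((M + 1 : ℕ) + 1) * h = Real.pi - h := by
      rw [hh]
      push_cast
      field_simp
      ring
    rw [this, Real.sin_pi_sub]
  have e : ∀ k ∈ Finset.range M, Real.sin ((k + 1) * h) * Real.sin (((k + 2 : ℕ) + 1) * h)
      = Real.sin (((k + 1 : ℕ) + 1) * h) ^ 2 - Real.sin h ^ 2 := fun k _ => by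
    have a1 : Real.sin (((k + 2 : ℕ) + 1) * h) = Real.sin (((k + 1 : ℕ) + 1) * h) * Real.cos h
        + Real.cos (((k + 1 : ℕ) + 1) * h) * Real.sin h := by
      rw [← Real.sin_add]
      push_cast
      ring_nf
    have a2 : Real.sin ((k + 1) * h) = Real.sin (((k + 1 : ℕ) + 1) * h) * Real.cos h
        - Real.cos (((k + 1 : ℕ) + 1) * h) * Real.sin h := by
      rw [← Real.sin_sub]
      push_cast
      ring_nf
    rw [a1, a2]
    linear_combination Real.sin (((k + 1 : ℕ) + 1) * h) ^ 2 * Real.sin_sq_add_cos_sq h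
      - Real.sin h ^ 2 * Real.sin_sq_add_cos_sq (((k + 1 : ℕ) + 1) * h)
  rw [Finset.sum_congr rfl e, Finset.sum_sub_distrib, Finset.sum_range_succ (n := M + 1), hend,
    Finset.sum_range_succ' (n := M)]
  simp
  ring

theorem polynomial_eq_of_eval_cos {p q : Polynomial ℝ}
    (h : ∀ θ : ℝ, p.eval (Real.cos θ) = q.eval (Real.cos θ)) : p = q := by
  refine Polynomial.eq_of_infinite_eval_eq p q
    ((Set.Icc_infinite (show (-1 : ℝ) < 1 by norm_num)).mono fun x hx => ?_)
  have := h (Real.arccos x)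
  rwa [Real.cos_arccos hx.1 hx.2] at this

/-- Univariate polynomials of degree at most `2 * N` that are visibly nonnegative on `[-1, 1]`. -/
def IsIntervalWeight (N : ℕ) (p : Polynomial ℝ) : Prop :=
  ∃ a b c d : Polynomial ℝ, a.natDegree ≤ N ∧ b.natDegree ≤ N ∧
    c.natDegree + 1 ≤ N ∧ d.natDegree + 1 ≤ N ∧
    p = a ^ 2 + b ^ 2 + ((1 - Polynomial.X ^ 2) * c ^ 2 + (1 - Polynomial.X ^ 2) * d ^ 2)

theorem exists_isIntervalWeight_eval_cos (N : ℕ) (hN : 0 < N) (q : ℕ → ℝ) (φ : ℝ) :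
    ∃ p, IsIntervalWeight N p ∧ ∀ θ : ℝ, p.eval (Real.cos θ)
      = ∑ k ∈ Finset.range N, ∑ l ∈ Finset.range N,
        q k * q l * (Real.cos ((k - l : ℝ) * φ) * Real.cos ((k - l : ℝ) * θ)) := by
  have degT : ∀ u : ℕ → ℝ, (∑ k ∈ Finset.range N, Polynomial.C (u k)
      * Polynomial.Chebyshev.T ℝ ((k : ℤ) + 1)).natDegree ≤ N := fun u => by
    refine Polynomial.natDegree_sum_le_of_forall_le _ _ fun k hk => ?_
    refine (Polynomial.natDegree_C_mul_le _ _).trans ?_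
    rw [Polynomial.Chebyshev.natDegree_T]
    have := Finset.mem_range.1 hk
    omega
  have degU : ∀ u : ℕ → ℝ, (∑ k ∈ Finset.range N, Polynomial.C (u k)
      * Polynomial.Chebyshev.U ℝ (k : ℤ)).natDegree + 1 ≤ N := fun u => by
    suffices (∑ k ∈ Finset.range N, Polynomial.C (u k)
      * Polynomial.Chebyshev.U ℝ (k : ℤ)).natDegree ≤ N - 1 by omega
    refine Polynomial.natDegree_sum_le_of_forall_le _ _ fun k hk => ?_
    refine (Polynomial.natDegree_C_mul_le _ _).trans ?_
    rw [Polynomial.Chebyshev.natDegree_U_natCast]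
    have := Finset.mem_range.1 hk
    omega
  have evalT : ∀ (u : ℕ → ℝ) (θ : ℝ), (∑ k ∈ Finset.range N, Polynomial.C (u k)
      * Polynomial.Chebyshev.T ℝ ((k : ℤ) + 1)).eval (Real.cos θ)
      = ∑ k ∈ Finset.range N, u k * Real.cos ((k + 1) * θ) := fun u θ => by
    rw [Polynomial.eval_finsetSum]
    refine Finset.sum_congr rfl fun k _ => ?_
    rw [Polynomial.eval_mul, Polynomial.eval_C, Polynomial.Chebyshev.T_real_cos]
    push_cast
    rfl
  have evalU : ∀ (u : ℕ → ℝ) (θ : ℝ), (∑ k ∈ Finset.range N, Polynomial.C (u k)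
      * Polynomial.Chebyshev.U ℝ (k : ℤ)).eval (Real.cos θ) * Real.sin θ
      = ∑ k ∈ Finset.range N, u k * Real.sin ((k + 1) * θ) := fun u θ => by
    rw [Polynomial.eval_finsetSum, Finset.sum_mul]
    refine Finset.sum_congr rfl fun k _ => ?_
    rw [Polynomial.eval_mul, Polynomial.eval_C, mul_assoc, Polynomial.Chebyshev.U_real_cos]
    push_cast
    rfl
  refine ⟨_, ⟨_, _, _, _, degT fun k => q k * Real.cos ((k + 1) * φ),
    degT fun k => q k * Real.sin ((k + 1) * φ), degU fun k => q k * Real.cos ((k + 1) * φ),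
    degU fun k => q k * Real.sin ((k + 1) * φ), rfl⟩, fun θ => ?_⟩
  have hs : ∀ x : ℝ, (1 - Real.cos θ ^ 2) * x ^ 2 = (x * Real.sin θ) ^ 2 := fun x => by
    rw [mul_pow, Real.sin_sq]
    ring
  simp only [Polynomial.eval_add, Polynomial.eval_mul, Polynomial.eval_pow, Polynomial.eval_sub,
    Polynomial.eval_one, Polynomial.eval_X]
  rw [hs, hs, evalT, evalT, evalU, evalU]
  exact squares_eq_sum_cos N q φ θ

theorem exists_interval_kernel (N : ℕ) (hN : 2 ≤ N) :
    ∃ (P : ℕ) (v : Fin P → ℝ) (w : Fin P → Polynomial ℝ),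
      (∀ s, |v s| ≤ 1 / Real.cos (Real.pi / (N + 1))) ∧ (∀ s, IsIntervalWeight N (w s)) ∧
      ∑ s, w s = 1 ∧ ∑ s, Polynomial.C (v s) * w s = Polynomial.X ∧
      ∑ s, Polynomial.C (v s ^ 2) * w s = Polynomial.X ^ 2
        + Polynomial.C (Real.tan (Real.pi / (N + 1)) ^ 2)
          * (Polynomial.C ((N : ℝ) / (N + 1))
            - Polynomial.C (((N : ℝ) - 1) / (N + 1)) * Polynomial.X ^ 2) := by
  set h : ℝ := Real.pi / (N + 1) with hh
  have hN' : (2 : ℝ) ≤ N := by exact_mod_cast hN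
  have hcos : 0 < Real.cos h := by
    refine Real.cos_pos_of_mem_Ioo ⟨?_, ?_⟩
    · have : 0 < h := by positivity
      linarith [Real.pi_pos]
    · exact div_lt_div_of_pos_left Real.pi_pos two_pos (by linarith)
  set κ : ℝ := 2 / ((N + 2 : ℕ) * (N + 1)) with hκ
  have hκ0 : 0 ≤ κ := by positivity
  set q : ℕ → ℝ := fun k => √κ * Real.sin ((k + 1) * h) with hq
  have hqq : ∀ k j : ℕ, q k * q (k + j)
      = κ * (Real.sin ((k + 1) * h) * Real.sin (((k + j : ℕ) + 1) * h)) := fun k j => by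
    rw [hq]
    dsimp only
    rw [mul_mul_mul_comm, Real.mul_self_sqrt hκ0]
  choose w hw hwe using fun s : Fin (N + 2) =>
    exists_isIntervalWeight_eval_cos N (by omega) q (s * (2 * Real.pi / (N + 2 : ℕ)))
  have moment : ∀ j : ℕ, j ≤ 2 → ∀ θ : ℝ,
      ∑ s : Fin (N + 2), Real.cos (j * (s * (2 * Real.pi / (N + 2 : ℕ)))) * (w s).eval (Real.cos θ)
      = (N + 2 : ℕ) * Real.cos (j * θ) * ∑ k ∈ Finset.range (N - j), q k * q (k + j) := by
    intro j hj θ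
    rw [← sum_cos_mul_sum_cos N (N + 2) j (by omega) q θ, Finset.sum_range]
    exact Finset.sum_congr rfl fun s _ => by rw [hwe]
  have hNN : (0 : ℝ) < (N + 2 : ℕ) := by positivity
  have m0 : ∀ θ : ℝ, ∑ s, (w s).eval (Real.cos θ) = 1 := fun θ => by
    have := moment 0 (by norm_num) θ
    have hz : ∀ k : ℕ, q k * q (k + 0) = κ * Real.sin ((k + 1) * h) ^ 2 := fun k => by
      rw [hqq, add_zero, sq]
    simp only [Nat.cast_zero, zero_mul, Real.cos_zero, one_mul] at this
    rw [this, Nat.sub_zero, Finset.sum_congr rfl fun k _ => hz k, ← Finset.mul_sum,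
      sum_range_sin_sq N (by omega), hκ]
    field_simp
  have m1 : ∀ θ : ℝ, ∑ s : Fin (N + 2), Real.cos (s * (2 * Real.pi / (N + 2 : ℕ)))
      * (w s).eval (Real.cos θ) = Real.cos h * Real.cos θ := fun θ => by
    have := moment 1 (by norm_num) θ
    simp only [hqq, ← Finset.mul_sum, Nat.cast_one, one_mul] at this
    rw [this, sum_range_sin_mul_sin_succ N (by omega), hκ]
    field_simp
    rw [← hh]
  have m2 : ∀ θ : ℝ, ∑ s : Fin (N + 2), Real.cos (2 * (s * (2 * Real.pi / (N + 2 : ℕ))))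
      * (w s).eval (Real.cos θ)
      = (1 - 2 * N / (N + 1) * Real.sin h ^ 2) * Real.cos (2 * θ) := fun θ => by
    have := moment 2 le_rfl θ
    simp only [hqq, ← Finset.mul_sum, Nat.cast_ofNat] at this
    rw [this, sum_range_sin_mul_sin_succ_succ N hN, hκ]
    field_simp
    rw [← hh]
  refine ⟨N + 2, fun s => Real.cos (s * (2 * Real.pi / (N + 2 : ℕ))) / Real.cos h, w, fun s => ?_,
    hw, polynomial_eq_of_eval_cos fun θ => ?_, polynomial_eq_of_eval_cos fun θ => ?_,
    polynomial_eq_of_eval_cos fun θ => ?_⟩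
  · rw [abs_div, abs_of_pos hcos]
    gcongr
    exact Real.abs_cos_le_one _
  · rw [Polynomial.eval_finsetSum, m0, Polynomial.eval_one]
  · simp only [Polynomial.eval_finsetSum, Polynomial.eval_mul, Polynomial.eval_C,
      Polynomial.eval_X, div_mul_eq_mul_div]
    rw [← Finset.sum_div, m1, mul_div_cancel_left₀ _ hcos.ne']
  · simp only [Polynomial.eval_finsetSum, Polynomial.eval_mul, Polynomial.eval_C,
      Polynomial.eval_X, Polynomial.eval_add, Polynomial.eval_sub, Polynomial.eval_pow]
    have e : ∀ s : Fin (N + 2), (Real.cos (s * (2 * Real.pi / (N + 2 : ℕ))) / Real.cos h) ^ 2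
        * (w s).eval (Real.cos θ)
        = (Real.cos (2 * (s * (2 * Real.pi / (N + 2 : ℕ)))) * (w s).eval (Real.cos θ)
          + (w s).eval (Real.cos θ)) / (2 * Real.cos h ^ 2) := fun s => by
      rw [Real.cos_two_mul]
      field_simp
      ring
    rw [Finset.sum_congr rfl fun s _ => e s, ← Finset.sum_div, Finset.sum_add_distrib, m0, m2,
      Real.cos_two_mul, Real.tan_eq_sin_div_cos, div_pow, Real.sin_sq]
    field_simp
    ring

/-- Generators of the truncated preordering of the transport polytope in degree `D`. -/
def preorderGenerators (a b D : ℕ) (μ : Fin a → ℝ) (ν : Fin b → ℝ) :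
    Set (MvPolynomial (Fin a × Fin b) ℝ) :=
  {p | (∃ I q, p = eI I * q ^ 2 ∧ p.totalDegree ≤ D) ∨
    (∃ i l, p = l * rowPoly a b μ i ∧ l.totalDegree + 1 ≤ D) ∨
    (∃ j l, p = l * colPoly a b ν j ∧ l.totalDegree + 1 ≤ D)}

/-- The truncated preordering of the transport polytope in degree `D`, as an additive monoid. -/
noncomputable def preorderCone (a b D : ℕ) (μ : Fin a → ℝ) (ν : Fin b → ℝ) :
    AddSubmonoid (MvPolynomial (Fin a × Fin b) ℝ) :=
  AddSubmonoid.closure (preorderGenerators a b D μ ν)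

section PreorderCone

variable {a b : ℕ} {μ : Fin a → ℝ} {ν : Fin b → ℝ}

theorem totalDegree_rowPoly_le (i : Fin a) : (rowPoly a b μ i).totalDegree ≤ 1 :=
  (totalDegree_sub_C_le _ _).trans <| totalDegree_finsetSum_le fun _ _ => (totalDegree_X _).le

theorem totalDegree_colPoly_le (j : Fin b) : (colPoly a b ν j).totalDegree ≤ 1 :=
  (totalDegree_sub_C_le _ _).trans <| totalDegree_finsetSum_le fun _ _ => (totalDegree_X _).le

theorem preorderCone_mono {D D' : ℕ} (h : D ≤ D') :
    preorderCone a b D μ ν ≤ preorderCone a b D' μ ν := by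
  refine AddSubmonoid.closure_mono ?_
  rintro p (⟨I, q, hp, hd⟩ | ⟨i, l, hp, hd⟩ | ⟨j, l, hp, hd⟩)
  · exact Or.inl ⟨I, q, hp, hd.trans h⟩
  · exact Or.inr (Or.inl ⟨i, l, hp, hd.trans h⟩)
  · exact Or.inr (Or.inr ⟨j, l, hp, hd.trans h⟩)

theorem eI_mul_sq_mem_preorderCone {D : ℕ} (I : Finset (Fin a × Fin b))
    (q : MvPolynomial (Fin a × Fin b) ℝ) (h : (eI I * q ^ 2).totalDegree ≤ D) :
    eI I * q ^ 2 ∈ preorderCone a b D μ ν :=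
  AddSubmonoid.subset_closure (Or.inl ⟨I, q, rfl, h⟩)

theorem mul_rowPoly_mem_preorderCone {D : ℕ} (i : Fin a) {l : MvPolynomial (Fin a × Fin b) ℝ}
    (h : l.totalDegree + 1 ≤ D) : l * rowPoly a b μ i ∈ preorderCone a b D μ ν :=
  AddSubmonoid.subset_closure (Or.inr (Or.inl ⟨i, l, rfl, h⟩))

theorem mul_colPoly_mem_preorderCone {D : ℕ} (j : Fin b) {l : MvPolynomial (Fin a × Fin b) ℝ}
    (h : l.totalDegree + 1 ≤ D) : l * colPoly a b ν j ∈ preorderCone a b D μ ν :=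
  AddSubmonoid.subset_closure (Or.inr (Or.inr ⟨j, l, rfl, h⟩))

theorem sq_mem_preorderCone {D : ℕ} {q : MvPolynomial (Fin a × Fin b) ℝ}
    (h : 2 * q.totalDegree ≤ D) : q ^ 2 ∈ preorderCone a b D μ ν := by
  have := eI_mul_sq_mem_preorderCone (D := D) (μ := μ) (ν := ν) ∅ q
  rw [eI, Finset.prod_empty, one_mul] at this
  exact this ((totalDegree_pow _ _).trans h)

theorem C_mem_preorderCone {D : ℕ} {c : ℝ} (hc : 0 ≤ c) :
    (C c : MvPolynomial (Fin a × Fin b) ℝ) ∈ preorderCone a b D μ ν := by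
  rw [← Real.sq_sqrt hc, C_pow]
  exact sq_mem_preorderCone (by rw [totalDegree_C]; omega)

theorem eI_mul_eI (I J : Finset (Fin a × Fin b)) :
    eI I * eI J = eI (symmDiff I J) * eI (I ∩ J) ^ 2 := by
  have hd : Disjoint (I \ J) (J \ I) := disjoint_sdiff_sdiff
  have h1 : eI (symmDiff I J) = eI (I \ J) * eI (J \ I) := Finset.prod_union hd
  have h2 : eI I = eI (I ∩ J) * eI (I \ J) := (Finset.prod_inter_mul_prod_sdiff I J _).symm
  have h3 : eI J = eI (I ∩ J) * eI (J \ I) := by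
    rw [Finset.inter_comm]
    exact (Finset.prod_inter_mul_prod_sdiff J I _).symm
  rw [h1, h2, h3]
  ring

theorem mul_mem_preorderCone {D₁ D₂ : ℕ} {p q : MvPolynomial (Fin a × Fin b) ℝ}
    (hp : p ∈ preorderCone a b D₁ μ ν) (hq : q ∈ preorderCone a b D₂ μ ν) :
    p * q ∈ preorderCone a b (D₁ + D₂) μ ν := by
  have gen : ∀ p ∈ preorderGenerators a b D₁ μ ν, ∀ q ∈ preorderGenerators a b D₂ μ ν,
      p * q ∈ preorderCone a b (D₁ + D₂) μ ν := by
    have deg : ∀ p ∈ preorderGenerators a b D₁ μ ν, p.totalDegree ≤ D₁ := by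
      rintro p (⟨I, f, rfl, hp⟩ | ⟨i, l, rfl, hp⟩ | ⟨i, l, rfl, hp⟩)
      · exact hp
      · exact (totalDegree_mul _ _).trans
          ((add_le_add_right (totalDegree_rowPoly_le i) _).trans hp)
      · exact (totalDegree_mul _ _).trans
          ((add_le_add_right (totalDegree_colPoly_le i) _).trans hp)
    intro p hp q hq
    have hpd := deg p hp
    rcases hq with ⟨J, g, rfl, hq⟩ | ⟨j, l, rfl, hq⟩ | ⟨j, l, rfl, hq⟩
    · rcases hp with ⟨I, f, rfl, hp⟩ | ⟨i, l, rfl, hp⟩ | ⟨i, l, rfl, hp⟩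
      · have e : eI I * f ^ 2 * (eI J * g ^ 2)
            = eI (symmDiff I J) * (eI (I ∩ J) * f * g) ^ 2 := by
          linear_combination (f ^ 2 * g ^ 2) * eI_mul_eI I J
        have hd := (totalDegree_mul (eI I * f ^ 2) (eI J * g ^ 2)).trans (add_le_add hp hq)
        rw [e] at hd ⊢
        exact eI_mul_sq_mem_preorderCone _ _ hd
      · rw [mul_right_comm]
        have := totalDegree_mul l (eI J * g ^ 2)
        exact mul_rowPoly_mem_preorderCone _ (by omega)
      · rw [mul_right_comm]
        have := totalDegree_mul l (eI J * g ^ 2)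
        exact mul_colPoly_mem_preorderCone _ (by omega)
    · rw [← mul_assoc]
      have := totalDegree_mul p l
      exact mul_rowPoly_mem_preorderCone _ (by omega)
    · rw [← mul_assoc]
      have := totalDegree_mul p l
      exact mul_colPoly_mem_preorderCone _ (by omega)
  refine AddSubmonoid.closure_induction (motive := fun p _ => p * q ∈ preorderCone a b _ μ ν)
    (fun p hp => ?_) ?_ (fun x y _ _ h1 h2 => ?_) hp
  · refine AddSubmonoid.closure_induction (motive := fun q _ => p * q ∈ preorderCone a b _ μ ν)
      (fun q hq => gen p hp q hq) ?_ (fun x y _ _ h1 h2 => ?_) hq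
    · rw [mul_zero]
      exact zero_mem _
    · rw [mul_add]
      exact add_mem h1 h2
  · rw [zero_mul]
    exact zero_mem _
  · rw [add_mul]
    exact add_mem h1 h2

theorem C_mul_mem_preorderCone {D : ℕ} {c : ℝ} (hc : 0 ≤ c)
    {p : MvPolynomial (Fin a × Fin b) ℝ} (hp : p ∈ preorderCone a b D μ ν) :
    C c * p ∈ preorderCone a b D μ ν := by
  have := mul_mem_preorderCone (C_mem_preorderCone (D := 0) hc) hp
  rwa [zero_add] at this

theorem prod_mem_preorderCone {D : ℕ} {ι : Type*} (s : Finset ι)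
    (f : ι → MvPolynomial (Fin a × Fin b) ℝ) (h : ∀ i ∈ s, f i ∈ preorderCone a b D μ ν) :
    ∏ i ∈ s, f i ∈ preorderCone a b (s.card * D) μ ν := by
  classical
  induction s using Finset.induction_on with
  | empty =>
    rw [Finset.prod_empty, ← C_1]
    exact C_mem_preorderCone zero_le_one
  | insert i s hi ih =>
    rw [Finset.prod_insert hi, Finset.card_insert_of_notMem hi, add_mul, one_mul, add_comm]
    exact mul_mem_preorderCone (h i (Finset.mem_insert_self _ _))
      (ih fun j hj => h j (Finset.mem_insert_of_mem hj))

theorem IsSOS.add {σ : Type*} {p q : MvPolynomial σ ℝ} (hp : IsSOS p) (hq : IsSOS q) :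
    IsSOS (p + q) := by
  obtain ⟨k, f, rfl⟩ := hp
  obtain ⟨l, g, rfl⟩ := hq
  refine ⟨k + l, Fin.append f g, ?_⟩
  simp only [Fin.sum_univ_add, Fin.append_left, Fin.append_right]

theorem isSOS_zero {σ : Type*} : IsSOS (0 : MvPolynomial σ ℝ) := ⟨0, Fin.elim0, by simp⟩

theorem isSOS_sq {σ : Type*} (q : MvPolynomial σ ℝ) : IsSOS (q ^ 2) := ⟨1, fun _ => q, by simp⟩

theorem inPreT_of_mem_preorderCone {r : ℕ} {p : MvPolynomial (Fin a × Fin b) ℝ}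
    (hp : p ∈ preorderCone a b (2 * r) μ ν) : InPreT a b r μ ν p := by
  refine AddSubmonoid.closure_induction (motive := fun p _ => InPreT a b r μ ν p) ?_ ?_ ?_ hp
  · rintro p (⟨I, q, rfl, h⟩ | ⟨i, l, rfl, h⟩ | ⟨j, l, rfl, h⟩)
    · refine ⟨0, fun J => if J = I then q ^ 2 else 0, 0, 0, isSOS_zero, by simp, fun J => ?_,
        by simp, by simp, by simp⟩
      dsimp only
      split_ifs with hJ
      · subst hJ
        exact ⟨isSOS_sq q, h⟩
      · exact ⟨isSOS_zero, by simp⟩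
    · refine ⟨0, 0, fun k => if k = i then l else 0, 0, isSOS_zero, by simp,
        fun J => ⟨isSOS_zero, by simp⟩, fun k => ?_, by simp, by simp⟩
      dsimp only
      split_ifs
      · omega
      · simp
    · refine ⟨0, 0, 0, fun k => if k = j then l else 0, isSOS_zero, by simp,
        fun J => ⟨isSOS_zero, by simp⟩, by simp, fun k => ?_, by simp⟩
      dsimp only
      split_ifs
      · omega
      · simp
  · exact ⟨0, 0, 0, 0, isSOS_zero, by simp, fun J => ⟨isSOS_zero, by simp⟩, by simp, by simp,
      by simp⟩
  · rintro p q _ _ ⟨s, S, l, t, h1, h2, h3, h4, h5, rfl⟩ ⟨s', S', l', t', k1, k2, k3, k4, k5, rfl⟩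
    refine ⟨s + s', S + S', l + l', t + t', h1.add k1,
      (totalDegree_add _ _).trans (max_le h2 k2), fun I => ⟨(h3 I).1.add (k3 I).1, ?_⟩,
      fun i => (totalDegree_add _ _).trans (max_le (h4 i) (k4 i)),
      fun j => (totalDegree_add _ _).trans (max_le (h5 j) (k5 j)), ?_⟩
    · rw [Pi.add_apply, mul_add]
      exact (totalDegree_add _ _).trans (max_le (h3 I).2 (k3 I).2)
    · simp only [Pi.add_apply, mul_add, add_mul, Finset.sum_add_distrib]
      ring

theorem totalDegree_aeval_le {σ : Type*} (p : Polynomial ℝ) {u : MvPolynomial σ ℝ}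
    (hu : u.totalDegree ≤ 1) : (Polynomial.aeval u p).totalDegree ≤ p.natDegree := by
  rw [Polynomial.aeval_eq_sum_range]
  refine totalDegree_finsetSum_le fun i hi => (totalDegree_smul_le _ _).trans ?_
  have := Finset.mem_range.1 hi
  exact (totalDegree_pow _ _).trans ((Nat.mul_le_mul_left i hu).trans (by omega))

theorem totalDegree_two_mul_X_sub_one_le (p : Fin a × Fin b) :
    (2 * X p - 1 : MvPolynomial (Fin a × Fin b) ℝ).totalDegree ≤ 1 := by
  have h : (2 * X p - 1 : MvPolynomial (Fin a × Fin b) ℝ) = C 2 * X p - C 1 := by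
    rw [map_ofNat, C_1]
  rw [h]
  refine (totalDegree_sub_C_le _ _).trans ((totalDegree_mul _ _).trans ?_)
  rw [totalDegree_C, totalDegree_X]

theorem one_sub_sq_mul_sq_mem_preorderCone (hμ : ∑ i, μ i = 1) {D : ℕ} (p : Fin a × Fin b)
    (q : MvPolynomial (Fin a × Fin b) ℝ) (hq : 2 * q.totalDegree + 2 ≤ D) :
    (1 - (2 * X p - 1) ^ 2) * q ^ 2 ∈ preorderCone a b D μ ν := by
  have hX : ∑ x : Fin a × Fin b, (X x : MvPolynomial (Fin a × Fin b) ℝ)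
      = ∑ i, rowPoly a b μ i + 1 := by
    simp only [rowPoly, Finset.sum_sub_distrib, Fintype.sum_prod_type]
    rw [← map_sum, hμ, C_1, sub_add_cancel]
  have e : (1 - (2 * X p - 1) ^ 2) * q ^ 2
      = ∑ x ∈ Finset.univ.erase p, eI {p, x} * (2 * q) ^ 2
        + ∑ i, (-(X p * (2 * q) ^ 2)) * rowPoly a b μ i := by
    have h1 : ∑ x ∈ Finset.univ.erase p, eI {p, x} * (2 * q) ^ 2
        = X p * (∑ x ∈ Finset.univ.erase p, X x) * (2 * q) ^ 2 := by
      rw [Finset.mul_sum, Finset.sum_mul]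
      refine Finset.sum_congr rfl fun x hx => ?_
      rw [eI, Finset.prod_pair (Finset.ne_of_mem_erase hx).symm]
    rw [h1, ← Finset.mul_sum, Finset.sum_erase_eq_sub (Finset.mem_univ p), hX]
    ring
  have h2q : (2 * q).totalDegree ≤ q.totalDegree := by
    have : (2 : MvPolynomial (Fin a × Fin b) ℝ) = C 2 := (map_ofNat C 2).symm
    rw [this]
    refine (totalDegree_mul _ _).trans ?_
    rw [totalDegree_C, zero_add]
  have hsq := (totalDegree_pow (2 * q) 2).trans (Nat.mul_le_mul_left 2 h2q)
  rw [e]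
  refine add_mem (sum_mem fun x hx => eI_mul_sq_mem_preorderCone _ _ ?_)
    (sum_mem fun i _ => mul_rowPoly_mem_preorderCone _ ?_)
  · rw [eI, Finset.prod_pair (Finset.ne_of_mem_erase hx).symm]
    have h1 := totalDegree_mul (X p * X x) ((2 * q) ^ 2)
    have h2 := totalDegree_mul (X p : MvPolynomial (Fin a × Fin b) ℝ) (X x)
    rw [totalDegree_X, totalDegree_X] at h2
    omega
  · rw [totalDegree_neg]
    have h1 := totalDegree_mul (X p) ((2 * q) ^ 2)
    rw [totalDegree_X] at h1
    omega

theorem IsIntervalWeight.aeval_mem_preorderCone (hμ : ∑ i, μ i = 1) {N : ℕ} {w : Polynomial ℝ}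
    (hw : IsIntervalWeight N w) (p : Fin a × Fin b) :
    Polynomial.aeval (2 * X p - 1 : MvPolynomial (Fin a × Fin b) ℝ) w
      ∈ preorderCone a b (2 * N) μ ν := by
  obtain ⟨f, g, c, d, hf, hg, hc, hd, rfl⟩ := hw
  have deg := fun q : Polynomial ℝ => totalDegree_aeval_le q (totalDegree_two_mul_X_sub_one_le p)
  simp only [map_add, map_mul, map_pow, map_sub, map_one, Polynomial.aeval_X]
  refine add_mem (add_mem (sq_mem_preorderCone ?_) (sq_mem_preorderCone ?_))
    (add_mem (one_sub_sq_mul_sq_mem_preorderCone hμ _ _ ?_)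
      (one_sub_sq_mul_sq_mem_preorderCone hμ _ _ ?_))
  · have := deg f
    omega
  · have := deg g
    omega
  · have := deg c
    omega
  · have := deg d
    omega

end PreorderCone

section TensorQuadrature

variable {ι κ A : Type*} [Fintype ι] [DecidableEq ι] [Fintype κ] [CommRing A]

theorem sum_prod_mul_prod (w g : ι → κ → A) :
    ∑ f : ι → κ, (∏ i, w i (f i)) * ∏ i, g i (f i) = ∏ i, ∑ s, w i s * g i s := by
  rw [Fintype.prod_sum]
  simp only [Finset.prod_mul_distrib]

theorem sum_prod_eq_one (w : ι → κ → A) (hw : ∀ i, ∑ s, w i s = 1) :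
    ∑ f : ι → κ, ∏ i, w i (f i) = 1 := by
  rw [← Fintype.prod_sum]
  exact Finset.prod_eq_one fun i _ => hw i

theorem sum_prod_mul_apply (w : ι → κ → A) (x : κ → A) (m : ι → A) (hw : ∀ i, ∑ s, w i s = 1)
    (hm : ∀ i, ∑ s, w i s * x s = m i) (p : ι) :
    ∑ f : ι → κ, (∏ i, w i (f i)) * x (f p) = m p := by
  have h := sum_prod_mul_prod w fun i s => if i = p then x s else 1
  simp only [Finset.prod_ite_eq', Finset.mem_univ, if_true] at h
  rw [h, Finset.prod_eq_single p (fun i _ hi => by simp [hi, hw]) (by simp)]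
  simp [hm]

theorem sum_prod_mul_apply_mul_apply (w : ι → κ → A) (x : κ → A) (m e : ι → A)
    (hw : ∀ i, ∑ s, w i s = 1) (hm : ∀ i, ∑ s, w i s * x s = m i)
    (he : ∀ i, ∑ s, w i s * x s ^ 2 = m i ^ 2 + e i) (p q : ι) :
    ∑ f : ι → κ, (∏ i, w i (f i)) * (x (f p) * x (f q))
      = m p * m q + if p = q then e p else 0 := by
  by_cases hpq : p = q
  · subst hpq
    have h := sum_prod_mul_apply w (fun s => x s ^ 2) _ hw he p
    simp only [← sq, if_true]
    exact h
  · have h := sum_prod_mul_prod w fun i s =>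
      (if i = p then x s else 1) * (if i = q then x s else 1)
    simp only [Finset.prod_mul_distrib, Finset.prod_ite_eq', Finset.mem_univ, if_true] at h
    rw [h, if_neg hpq, add_zero]
    have e1 : ∀ i, ∑ s, w i s * ((if i = p then x s else 1) * (if i = q then x s else 1))
        = (if i = p then m p else 1) * (if i = q then m q else 1) := fun i => by
      by_cases h1 : i = p
      · subst h1
        simp [hpq, hm]
      · by_cases h2 : i = q
        · subst h2
          simp [h1, hm]
        · simp [h1, h2, hw]
    simp only [e1, Finset.prod_mul_distrib, Finset.prod_ite_eq', Finset.mem_univ, if_true]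

end TensorQuadrature

section Rounding

theorem exists_row_sum_le {α β : Type*} [Fintype α] [Fintype β] {μ : α → ℝ} (hμ : ∀ i, 0 ≤ μ i)
    {z : α → β → ℝ} (hz : ∀ i j, 0 ≤ z i j) :
    ∃ y : α → β → ℝ, (∀ i j, 0 ≤ y i j) ∧ (∀ i j, y i j ≤ z i j) ∧ (∀ i, ∑ j, y i j ≤ μ i) ∧
      ∑ i, ∑ j, (z i j - y i j) ≤ ∑ i, |∑ j, z i j - μ i| := by
  have hr : ∀ i, 0 ≤ ∑ j, z i j := fun i => Finset.sum_nonneg fun j _ => hz i j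
  have hsum : ∀ i, ∑ j, z i j * min 1 (μ i / ∑ j, z i j) = min (∑ j, z i j) (μ i) := fun i => by
    rw [← Finset.sum_mul]
    rcases (hr i).eq_or_lt' with h | h
    · rw [h, zero_mul, min_eq_left (hμ i)]
    · rw [mul_min_of_nonneg _ _ h.le, mul_one, mul_div_cancel₀ _ h.ne']
  refine ⟨fun i j => z i j * min 1 (μ i / ∑ j, z i j), fun i j => ?_, fun i j => ?_, fun i => ?_, ?_⟩
  · exact mul_nonneg (hz i j) (le_min zero_le_one (div_nonneg (hμ i) (hr i)))
  · exact mul_le_of_le_one_right (hz i j) (min_le_left _ _)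
  · rw [hsum]
    exact min_le_right _ _
  · refine Finset.sum_le_sum fun i _ => ?_
    rw [Finset.sum_sub_distrib, hsum]
    rcases min_cases (∑ j, z i j) (μ i) with h | h
    · rw [h.1, sub_self]
      exact abs_nonneg _
    · rw [h.1]
      exact le_abs_self _

theorem exists_mem_transportPolytope_near {a b : ℕ} {μ : Fin a → ℝ} {ν : Fin b → ℝ}
    (hμ : IsProbVec μ) (hν : IsProbVec ν) {z : Fin a → Fin b → ℝ} (hz : ∀ i j, 0 ≤ z i j) :
    ∃ π ∈ transportPolytope a b μ ν, ∑ i, ∑ j, |z i j - π i j|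
      ≤ 5 * (∑ i, |∑ j, z i j - μ i| + ∑ j, |∑ i, z i j - ν j|) := by
  obtain ⟨y, hy0, hyz, hyμ, hys⟩ := exists_row_sum_le hμ.1 hz
  obtain ⟨x', hx0', hxy', hxν', hxs'⟩ :=
    exists_row_sum_le hν.1 (z := fun j i => y i j) fun j i => hy0 i j
  obtain ⟨x, rfl⟩ : ∃ x : Fin a → Fin b → ℝ, x' = fun j i => x i j := ⟨fun i j => x' j i, rfl⟩
  dsimp only at hx0' hxy' hxν' hxs'
  have hrow : ∀ i, ∑ j, x i j ≤ μ i := fun i =>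
    (Finset.sum_le_sum fun j _ => hxy' j i).trans (hyμ i)
  have hcol : ∑ j, |∑ i, y i j - ν j| ≤ ∑ j, |∑ i, z i j - ν j| + ∑ i, ∑ j, (z i j - y i j) := by
    rw [Finset.sum_comm (f := fun i j => z i j - y i j), ← Finset.sum_add_distrib]
    refine Finset.sum_le_sum fun j _ => ?_
    rw [Finset.sum_sub_distrib]
    have := Finset.sum_le_sum fun i (_ : i ∈ Finset.univ) => hyz i j
    rcases abs_cases (∑ i, y i j - ν j) with h | h <;>
      rcases abs_cases (∑ i, z i j - ν j) with h' | h' <;> linarith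
  have hzx : ∑ i, ∑ j, (z i j - x i j)
      ≤ 2 * ∑ i, |∑ j, z i j - μ i| + ∑ j, |∑ i, z i j - ν j| := by
    have h : ∑ i, ∑ j, (z i j - x i j)
        = ∑ i, ∑ j, (z i j - y i j) + ∑ j, ∑ i, (y i j - x i j) := by
      rw [Finset.sum_comm (f := fun j i => y i j - x i j)]
      simp only [← Finset.sum_add_distrib, sub_add_sub_cancel]
    linarith
  set E : ℝ := 1 - ∑ i, ∑ j, x i j with hE
  have hr0 : ∀ i, 0 ≤ μ i - ∑ j, x i j := fun i => sub_nonneg.2 (hrow i)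
  have hc0 : ∀ j, 0 ≤ ν j - ∑ i, x i j := fun j => sub_nonneg.2 (hxν' j)
  have hEr : ∑ i, (μ i - ∑ j, x i j) = E := by rw [Finset.sum_sub_distrib, hμ.2]
  have hEc : ∑ j, (ν j - ∑ i, x i j) = E := by
    rw [Finset.sum_sub_distrib, hν.2, Finset.sum_comm]
  have hE0 : 0 ≤ E := hEr ▸ Finset.sum_nonneg fun i _ => hr0 i
  have hrE : ∀ i, (μ i - ∑ j, x i j) * E / E = μ i - ∑ j, x i j := fun i => by
    rcases hE0.eq_or_lt' with h | h
    · rw [h, (Finset.sum_eq_zero_iff_of_nonneg fun i _ => hr0 i).1 (hEr.trans h) i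
        (Finset.mem_univ i), zero_mul, zero_div]
    · rw [mul_div_cancel_right₀ _ h.ne']
  have hcE : ∀ j, E * (ν j - ∑ i, x i j) / E = ν j - ∑ i, x i j := fun j => by
    rcases hE0.eq_or_lt' with h | h
    · rw [h, (Finset.sum_eq_zero_iff_of_nonneg fun j _ => hc0 j).1 (hEc.trans h) j
        (Finset.mem_univ j), zero_mul, zero_div]
    · rw [mul_div_cancel_left₀ _ h.ne']
  have hprod0 : ∀ i j, 0 ≤ (μ i - ∑ j, x i j) * (ν j - ∑ i, x i j) / E := fun i j =>
    div_nonneg (mul_nonneg (hr0 i) (hc0 j)) hE0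
  have hprodrow : ∀ i, ∑ j, (μ i - ∑ j, x i j) * (ν j - ∑ i, x i j) / E = μ i - ∑ j, x i j :=
    fun i => by rw [← Finset.sum_div, ← Finset.mul_sum, hEc, hrE]
  have hprodcol : ∀ j, ∑ i, (μ i - ∑ j, x i j) * (ν j - ∑ i, x i j) / E = ν j - ∑ i, x i j :=
    fun j => by rw [← Finset.sum_div, ← Finset.sum_mul, hEr, hcE]
  refine ⟨fun i j => x i j + (μ i - ∑ j, x i j) * (ν j - ∑ i, x i j) / E,
    ⟨fun i j => add_nonneg (hx0' j i) (hprod0 i j), fun i => ?_, fun j => ?_⟩, ?_⟩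
  · rw [Finset.sum_add_distrib, hprodrow, add_sub_cancel]
  · rw [Finset.sum_add_distrib, hprodcol, add_sub_cancel]
  · have hle : ∑ i, ∑ j, |z i j - (x i j + (μ i - ∑ j, x i j) * (ν j - ∑ i, x i j) / E)|
        ≤ ∑ i, ∑ j, ((z i j - x i j) + (μ i - ∑ j, x i j) * (ν j - ∑ i, x i j) / E) := by
      refine Finset.sum_le_sum fun i _ => Finset.sum_le_sum fun j _ => ?_
      have h1 := hprod0 i j
      have h2 := (hxy' j i).trans (hyz i j)
      rw [abs_le]
      constructor <;> linarith
    refine hle.trans ?_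
    simp only [Finset.sum_add_distrib (f := fun j => z _ j - x _ j), hprodrow]
    rw [Finset.sum_add_distrib, hEr]
    have hE1 : E ≤ ∑ i, |∑ j, z i j - μ i| + ∑ i, ∑ j, (z i j - x i j) := by
      rw [← hEr, ← Finset.sum_add_distrib]
      refine Finset.sum_le_sum fun i _ => ?_
      rw [Finset.sum_sub_distrib]
      have := neg_abs_le (∑ j, z i j - μ i)
      linarith
    have hc : 0 ≤ ∑ j, |∑ i, z i j - ν j| := Finset.sum_nonneg fun j _ => abs_nonneg _
    linarith

end Rounding

section PseudoExpectation

variable {Ω ι A : Type*} [DecidableEq ι] [CommRing A] [Algebra ℝ A]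

theorem map_sq_sum_sub (E : (Ω → ℝ) →ₗ[ℝ] A) (Z : ι → Ω → ℝ) (x e : ι → A) (h1 : E 1 = 1)
    (hZ : ∀ p, E (Z p) = x p)
    (hZZ : ∀ p q, E (Z p * Z q) = x p * x q + if p = q then e p else 0)
    {β : Type*} [Fintype β] [DecidableEq β] {g : β → ι} (hg : Function.Injective g) (c : ℝ) :
    E ((∑ j, Z (g j) - c • 1) ^ 2) = (∑ j, x (g j) - algebraMap ℝ A c) ^ 2 + ∑ j, e (g j) := by
  have hsq : (∑ j, Z (g j) - c • 1) ^ 2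
      = ∑ j, ∑ l, Z (g j) * Z (g l) - (2 * c) • ∑ j, Z (g j) + (c ^ 2) • 1 := by
    rw [← Finset.sum_mul_sum]
    ext ω
    simp only [Pi.pow_apply, Pi.sub_apply, Pi.add_apply, Pi.smul_apply, Pi.one_apply, Pi.mul_apply,
      smul_eq_mul]
    ring
  rw [hsq]
  simp only [map_add, map_sub, map_smul, map_sum, hZ, hZZ, h1, hg.eq_iff]
  simp only [Finset.sum_add_distrib, Finset.sum_ite_eq, Finset.mem_univ, if_true,
    ← Finset.sum_mul_sum, Algebra.smul_def, map_mul, map_pow, map_ofNat, mul_one]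
  ring

theorem map_sum_smul_mul (a b : ℕ) (L : Fin a → Fin b → Fin a → Fin b → ℝ)
    (E : (Ω → ℝ) →ₗ[ℝ] A) (Z : Fin a × Fin b → Ω → ℝ) (x e : Fin a × Fin b → A)
    (hZZ : ∀ p q, E (Z p * Z q) = x p * x q + if p = q then e p else 0) :
    E (∑ i, ∑ j, ∑ k, ∑ l, L i j k l • (Z (i, j) * Z (k, l)))
      = ∑ i, ∑ j, ∑ k, ∑ l, algebraMap ℝ A (L i j k l) * x (i, j) * x (k, l)
        + ∑ i, ∑ j, algebraMap ℝ A (L i j i j) * e (i, j) := by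
  simp only [map_sum, map_smul, hZZ]
  simp only [Algebra.smul_def, mul_add, Finset.sum_add_distrib, mul_ite, mul_zero,
    Prod.mk.injEq, ite_and, mul_assoc]
  congr 1
  refine Finset.sum_congr rfl fun i _ => Finset.sum_congr rfl fun j _ => ?_
  rw [Finset.sum_eq_single i (fun k _ hk => by simp [hk.symm]) (by simp)]
  simp

end PseudoExpectation

/-- The quadratic penalty for violating the marginal constraints. -/
def marginalPenalty (a b : ℕ) (μ : Fin a → ℝ) (ν : Fin b → ℝ) (z : Fin a → Fin b → ℝ) : ℝ :=
  ∑ i, (∑ j, z i j - μ i) ^ 2 + ∑ j, (∑ i, z i j - ν j) ^ 2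

theorem exists_tensor_kernel {a b : ℕ} {μ : Fin a → ℝ} (ν : Fin b → ℝ) (hμ : ∑ i, μ i = 1)
    (N : ℕ) (hN : 2 ≤ N) :
    ∃ (P : ℕ) (t : Fin P → ℝ) (W : (Fin a × Fin b → Fin P) → MvPolynomial (Fin a × Fin b) ℝ)
      (e : Fin a × Fin b → MvPolynomial (Fin a × Fin b) ℝ),
      (∀ s, |2 * t s - 1| ≤ 1 / Real.cos (Real.pi / (N + 1))) ∧
      (∀ f, W f ∈ preorderCone a b (a * b * (2 * N)) μ ν) ∧
      ∑ f, W f = 1 ∧ (∀ p, ∑ f, t (f p) • W f = X p) ∧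
      (∀ p q, ∑ f, (t (f p) * t (f q)) • W f = X p * X q + if p = q then e p else 0) ∧
      ∀ p, C (Real.tan (Real.pi / (N + 1)) ^ 2 / 4) - e p ∈ preorderCone a b 2 μ ν := by
  obtain ⟨P, v, w, hv, hw, hw0, hw1, hw2⟩ := exists_interval_kernel N hN
  set τ : ℝ := Real.tan (Real.pi / (N + 1)) ^ 2 with hτ
  let u : Fin a × Fin b → MvPolynomial (Fin a × Fin b) ℝ := fun p => 2 * X p - 1
  let ω : Fin a × Fin b → Fin P → MvPolynomial (Fin a × Fin b) ℝ :=
    fun p s => Polynomial.aeval (u p) (w s)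
  let t : Fin P → ℝ := fun s => (1 + v s) / 2
  let e : Fin a × Fin b → MvPolynomial (Fin a × Fin b) ℝ := fun p =>
    C (1 / 4) * (C τ * (C ((N : ℝ) / (N + 1)) - C (((N : ℝ) - 1) / (N + 1)) * u p ^ 2))
  have m0 : ∀ p, ∑ s, ω p s = 1 := fun p => by
    rw [← map_sum, hw0, map_one]
  have m1' : ∀ p, ∑ s, C (v s) * ω p s = u p := fun p => by
    have := congrArg (Polynomial.aeval (u p)) hw1
    simpa only [map_sum, map_mul, Polynomial.aeval_C, Polynomial.aeval_X, algebraMap_eq] using this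
  have m2' : ∀ p, ∑ s, C (v s ^ 2) * ω p s = u p ^ 2
      + C τ * (C ((N : ℝ) / (N + 1)) - C (((N : ℝ) - 1) / (N + 1)) * u p ^ 2) := fun p => by
    have := congrArg (Polynomial.aeval (u p)) hw2
    simpa only [map_sum, map_add, map_sub, map_mul, map_pow _ (Polynomial.X : Polynomial ℝ),
      Polynomial.aeval_C, Polynomial.aeval_X, algebraMap_eq] using this
  have half : ∀ y : MvPolynomial (Fin a × Fin b) ℝ, C (1 / 2) * (2 * y) = y := fun y => by
    rw [← mul_assoc, ← map_ofNat C 2, ← C_mul]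
    norm_num
  have m1 : ∀ p, ∑ s, ω p s * C (t s) = X p := fun p => by
    have : ∀ s, ω p s * C (t s) = C (1 / 2) * (ω p s + C (v s) * ω p s) := fun s => by
      have : C (t s) = (C (1 / 2) * (1 + C (v s)) : MvPolynomial (Fin a × Fin b) ℝ) := by
        rw [← C_1, ← C_add, ← C_mul]
        congr 1
        ring
      rw [this]
      ring
    simp only [this]
    rw [← Finset.mul_sum, Finset.sum_add_distrib, m0, m1', add_sub_cancel, half]
  have m2 : ∀ p, ∑ s, ω p s * C (t s) ^ 2 = X p ^ 2 + e p := fun p => by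
    have : ∀ s, ω p s * C (t s) ^ 2
        = C (1 / 4) * (ω p s + 2 * (C (v s) * ω p s) + C (v s ^ 2) * ω p s) := fun s => by
      have : C (t s) ^ 2
          = (C (1 / 4) * (1 + 2 * C (v s) + C (v s ^ 2)) : MvPolynomial (Fin a × Fin b) ℝ) := by
        rw [← map_ofNat C 2, ← C_1, ← C_mul, ← C_add, ← C_add, ← C_mul, ← C_pow]
        congr 1
        ring
      rw [this]
      ring
    simp only [this]
    rw [← Finset.mul_sum, Finset.sum_add_distrib, Finset.sum_add_distrib, ← Finset.mul_sum, m0,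
      m1', m2']
    have quarter : (C (1 / 4) * 4 : MvPolynomial (Fin a × Fin b) ℝ) = 1 := by
      rw [← map_ofNat C 4, ← C_mul]
      norm_num
    change C (1 / 4) * (1 + 2 * (2 * X p - 1) + ((2 * X p - 1) ^ 2 + _)) = X p ^ 2 + C (1 / 4) * _
    linear_combination X p ^ 2 * quarter
  refine ⟨P, t, fun f => ∏ p, ω p (f p), e, fun s => ?_, fun f => ?_, sum_prod_eq_one ω m0,
    fun p => ?_, fun p q => ?_, fun p => ?_⟩
  · have : 2 * t s - 1 = v s := by
      change 2 * ((1 + v s) / 2) - 1 = v s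
      ring
    rw [this]
    exact hv s
  · have := prod_mem_preorderCone (μ := μ) (ν := ν) Finset.univ (fun p => ω p (f p))
      fun p _ => (hw (f p)).aeval_mem_preorderCone hμ p
    simpa using this
  · simp only [smul_eq_C_mul, mul_comm (C _)]
    exact sum_prod_mul_apply ω (fun s => C (t s)) _ m0 m1 p
  · have : ∀ f : Fin a × Fin b → Fin P, (t (f p) * t (f q)) • ∏ p, ω p (f p)
        = (∏ p, ω p (f p)) * (C (t (f p)) * C (t (f q))) := fun f => by
      rw [smul_eq_C_mul, C_mul, mul_comm]
    simp only [this]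
    exact sum_prod_mul_apply_mul_apply ω (fun s => C (t s)) X e m0 m1 m2 p q
  · have hN' : (2 : ℝ) ≤ N := by exact_mod_cast hN
    have he : C (τ / 4) - e p
        = C (τ / 4 / (N + 1)) + C (τ / 4 * (((N : ℝ) - 1) / (N + 1))) * u p ^ 2 := by
      have h1 : C (τ / 4) = (C (1 / 4) * C τ * C ((N : ℝ) / (N + 1)) + C (τ / 4 / (N + 1)) :
          MvPolynomial (Fin a × Fin b) ℝ) := by
        rw [← C_mul, ← C_mul, ← C_add]
        congr 1
        field_simp
      have h2 : C (τ / 4 * (((N : ℝ) - 1) / (N + 1)))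
          = (C (1 / 4) * C τ * C (((N : ℝ) - 1) / (N + 1)) :
          MvPolynomial (Fin a × Fin b) ℝ) := by
        rw [← C_mul, ← C_mul]
        congr 1
        ring
      rw [h2, h1]
      ring
    have hτ0 : 0 ≤ τ := sq_nonneg _
    rw [he]
    refine add_mem (C_mem_preorderCone (by positivity)) (C_mul_mem_preorderCone
      (mul_nonneg (by positivity) (div_nonneg (by linarith) (by positivity)))
      (sq_mem_preorderCone ?_))
    have := totalDegree_two_mul_X_sub_one_le p
    change 2 * (2 * X p - 1 : MvPolynomial (Fin a × Fin b) ℝ).totalDegree ≤ 2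
    omega

theorem Lpoly_sub_C_mem_preorderCone {a b : ℕ} {μ : Fin a → ℝ} {ν : Fin b → ℝ}
    (hμ : ∑ i, μ i = 1) (L : Fin a → Fin b → Fin a → Fin b → ℝ) {N D : ℕ} (hN : 2 ≤ N)
    (hD : a * b * (2 * N) ≤ D) (hD2 : 2 ≤ D) {M c : ℝ} (hM : ∀ i j, 0 ≤ L i j i j + 2 * M)
    (hc : ∀ z : Fin a → Fin b → ℝ,
      (∀ i j, |2 * z i j - 1| ≤ 1 / Real.cos (Real.pi / (N + 1))) →
      c + ∑ i, ∑ j, (L i j i j + 2 * M) * (Real.tan (Real.pi / (N + 1)) ^ 2 / 4)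
        ≤ Lquad a b L z + M * marginalPenalty a b μ ν z) :
    Lpoly a b L - C c ∈ preorderCone a b D μ ν := by
  obtain ⟨P, t, W, e, ht, hW, hW0, hW1, hW2, he⟩ := exists_tensor_kernel (b := b) ν hμ N hN
  set δ : ℝ := Real.tan (Real.pi / (N + 1)) ^ 2 / 4
  set η : ℝ := ∑ i, ∑ j, (L i j i j + 2 * M) * δ with hη
  let E := Fintype.linearCombination ℝ W
  let Z : Fin a × Fin b → (Fin a × Fin b → Fin P) → ℝ := fun p f => t (f p)
  have hE1 : E 1 = 1 := by
    simpa only [E, Fintype.linearCombination_apply, Pi.one_apply, one_smul] using hW0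
  have hEZ : ∀ p, E (Z p) = X p := hW1
  have hEZZ : ∀ p q, E (Z p * Z q) = X p * X q + if p = q then e p else 0 := hW2
  let F : (Fin a × Fin b → Fin P) → ℝ := fun f =>
    Lquad a b L (fun i j => t (f (i, j))) + M * marginalPenalty a b μ ν (fun i j => t (f (i, j)))
      - (c + η)
  have hF : F = ∑ i, ∑ j, ∑ k, ∑ l, L i j k l • (Z (i, j) * Z (k, l))
      + M • (∑ i, (∑ j, Z (i, j) - μ i • 1) ^ 2 + ∑ j, (∑ i, Z (i, j) - ν j • 1) ^ 2)
      - (c + η) • 1 := by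
    ext f
    simp [F, Z, Lquad, marginalPenalty, mul_assoc, mul_add]
  have hEF : E F ∈ preorderCone a b D μ ν := by
    rw [Fintype.linearCombination_apply]
    refine sum_mem fun f _ => ?_
    rw [smul_eq_C_mul]
    exact C_mul_mem_preorderCone (sub_nonneg.2 (hc _ fun i j => ht _))
      (preorderCone_mono hD (hW f))
  have hrow := fun i => map_sq_sum_sub E Z X e hE1 hEZ hEZZ (Prod.mk_right_injective i) (μ i)
  have hcol := fun j => map_sq_sum_sub E Z X e hE1 hEZ hEZZ (Prod.mk_left_injective j) (ν j)
  have hval : E F = Lpoly a b L + ∑ i, ∑ j, C (L i j i j) * e (i, j)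
      + C M * ((∑ i, rowPoly a b μ i ^ 2 + ∑ i, ∑ j, e (i, j))
        + (∑ j, colPoly a b ν j ^ 2 + ∑ i, ∑ j, e (i, j))) - (C c + C η) := by
    rw [hF, map_sub, map_add, map_sum_smul_mul a b L E Z X e hEZZ, map_smul, map_smul, map_add,
      map_sum, map_sum, hE1]
    simp only [hrow, hcol, Finset.sum_add_distrib, algebraMap_eq, smul_eq_C_mul, C_add, mul_one]
    rw [Finset.sum_comm (f := fun j i => e (i, j))]
    rfl
  have hident : Lpoly a b L - C c = E F + ∑ i, ∑ j, C (L i j i j + 2 * M) * (C δ - e (i, j))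
      + ∑ i, (-(C M * rowPoly a b μ i)) * rowPoly a b μ i
      + ∑ j, (-(C M * colPoly a b ν j)) * colPoly a b ν j := by
    have h1 : ∑ i, ∑ j, C (L i j i j + 2 * M) * (C δ - e (i, j))
        = C η - ∑ i, ∑ j, C (L i j i j) * e (i, j) - 2 * C M * ∑ i, ∑ j, e (i, j) := by
      rw [hη]
      simp only [map_sum, Finset.mul_sum, ← Finset.sum_sub_distrib]
      refine Finset.sum_congr rfl fun i _ => Finset.sum_congr rfl fun j _ => ?_
      rw [C_mul, C_add, C_mul, map_ofNat]
      ring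
    have h2 : ∀ {κ : Type} [Fintype κ] (g : κ → MvPolynomial (Fin a × Fin b) ℝ),
        ∑ i, (-(C M * g i)) * g i = -(C M * ∑ i, g i ^ 2) := fun g => by
      rw [Finset.mul_sum, ← Finset.sum_neg_distrib]
      refine Finset.sum_congr rfl fun i _ => ?_
      ring
    rw [hval, h1, h2, h2]
    ring
  have hdeg : ∀ g : MvPolynomial (Fin a × Fin b) ℝ, g.totalDegree ≤ 1 →
      (-(C M * g)).totalDegree + 1 ≤ D := fun g hg => by
    have := totalDegree_mul (C M) g
    rw [totalDegree_C] at this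
    rw [totalDegree_neg]
    omega
  rw [hident]
  refine add_mem (add_mem (add_mem hEF (sum_mem fun i _ => sum_mem fun j _ => ?_))
    (sum_mem fun i _ => ?_)) (sum_mem fun j _ => ?_)
  · exact C_mul_mem_preorderCone (hM i j) (preorderCone_mono hD2 (he _))
  · exact mul_rowPoly_mem_preorderCone _ (hdeg _ (totalDegree_rowPoly_le i))
  · exact mul_colPoly_mem_preorderCone _ (hdeg _ (totalDegree_colPoly_le j))

section Objective

variable {a b : ℕ} {μ : Fin a → ℝ} {ν : Fin b → ℝ} (L : Fin a → Fin b → Fin a → Fin b → ℝ)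

theorem abs_le_Kmax (i : Fin a) (j : Fin b) (k : Fin a) (l : Fin b) :
    |L i j k l| ≤ Kmax a b L := by
  refine le_csSup (Set.Finite.bddAbove ?_) ⟨i, j, k, l, rfl⟩
  refine (Set.finite_range fun p : Fin a × Fin b × Fin a × Fin b =>
    |L p.1 p.2.1 p.2.2.1 p.2.2.2|).subset ?_
  rintro _ ⟨i, j, k, l, rfl⟩
  exact ⟨(i, j, k, l), rfl⟩

theorem Kmax_nonneg : 0 ≤ Kmax a b L :=
  Real.sSup_nonneg fun _ ⟨_, _, _, _, h⟩ => h ▸ abs_nonneg _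

theorem abs_Lquad_sub_le (z π : Fin a → Fin b → ℝ) :
    |Lquad a b L z - Lquad a b L π| ≤
      Kmax a b L * ((∑ i, ∑ j, |z i j| + ∑ i, ∑ j, |π i j|) * ∑ i, ∑ j, |z i j - π i j|) := by
  have key : ∀ i j k l, |L i j k l * z i j * z k l - L i j k l * π i j * π k l|
      ≤ Kmax a b L * (|z i j| * |z k l - π k l| + |z i j - π i j| * |π k l|) := fun i j k l => by
    have : L i j k l * z i j * z k l - L i j k l * π i j * π k l
        = L i j k l * (z i j * (z k l - π k l) + (z i j - π i j) * π k l) := by ring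
    rw [this, abs_mul, ← abs_mul (z i j), ← abs_mul (z i j - π i j)]
    exact mul_le_mul (abs_le_Kmax L i j k l) (abs_add_le _ _) (abs_nonneg _) (Kmax_nonneg L)
  have hsum : ∀ f g : Fin a → Fin b → ℝ, ∑ i, ∑ j, ∑ k, ∑ l, f i j * g k l
      = (∑ i, ∑ j, f i j) * ∑ i, ∑ j, g i j := fun f g => by
    simp only [← Finset.mul_sum, ← Finset.sum_mul]
  calc |Lquad a b L z - Lquad a b L π|
      = |∑ i, ∑ j, ∑ k, ∑ l, (L i j k l * z i j * z k l - L i j k l * π i j * π k l)| := by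
        simp only [Lquad, Finset.sum_sub_distrib]
    _ ≤ ∑ i, ∑ j, ∑ k, ∑ l, Kmax a b L *
          (|z i j| * |z k l - π k l| + |z i j - π i j| * |π k l|) := by
        refine (Finset.abs_sum_le_sum_abs _ _).trans (Finset.sum_le_sum fun i _ => ?_)
        refine (Finset.abs_sum_le_sum_abs _ _).trans (Finset.sum_le_sum fun j _ => ?_)
        refine (Finset.abs_sum_le_sum_abs _ _).trans (Finset.sum_le_sum fun k _ => ?_)
        exact (Finset.abs_sum_le_sum_abs _ _).trans (Finset.sum_le_sum fun l _ => key i j k l)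
    _ = _ := by
        simp only [← Finset.mul_sum (a := Kmax a b L), Finset.sum_add_distrib]
        rw [hsum, hsum (fun i j => |z i j - π i j|)]
        ring

theorem sum_sum_abs_eq_one (hμ : IsProbVec μ) {π : Fin a → Fin b → ℝ}
    (hπ : π ∈ transportPolytope a b μ ν) : ∑ i, ∑ j, |π i j| = 1 := by
  simp only [abs_of_nonneg (hπ.1 _ _), hπ.2.1, hμ.2]

theorem abs_Lquad_le (hμ : IsProbVec μ) {π : Fin a → Fin b → ℝ}
    (hπ : π ∈ transportPolytope a b μ ν) : |Lquad a b L π| ≤ Kmax a b L := by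
  have := abs_Lquad_sub_le L π 0
  simpa [sum_sum_abs_eq_one hμ hπ, Lquad] using this

theorem transportPolytope_nonempty (hμ : IsProbVec μ) (hν : IsProbVec ν) :
    (transportPolytope a b μ ν).Nonempty :=
  ⟨fun i j => μ i * ν j, fun i j => mul_nonneg (hμ.1 i) (hν.1 j),
    fun i => by rw [← Finset.mul_sum, hν.2, mul_one],
    fun j => by rw [← Finset.sum_mul, hμ.2, one_mul]⟩

theorem DGW_le_Lquad (hμ : IsProbVec μ) {π : Fin a → Fin b → ℝ}
    (hπ : π ∈ transportPolytope a b μ ν) : DGW a b μ ν L ≤ Lquad a b L π :=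
  csInf_le ⟨-Kmax a b L, by rintro _ ⟨ρ, hρ, rfl⟩; exact (abs_le.1 (abs_Lquad_le L hμ hρ)).1⟩
    ⟨π, hπ, rfl⟩

theorem DGW_le_Kmax (hμ : IsProbVec μ) (hν : IsProbVec ν) : DGW a b μ ν L ≤ Kmax a b L := by
  obtain ⟨π, hπ⟩ := transportPolytope_nonempty hμ hν
  exact (DGW_le_Lquad L hμ hπ).trans (abs_le.1 (abs_Lquad_le L hμ hπ)).2

theorem IsSOS.eval_nonneg {σ : Type*} {p : MvPolynomial σ ℝ} (hp : IsSOS p) (x : σ → ℝ) :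
    0 ≤ eval x p := by
  obtain ⟨k, q, rfl⟩ := hp
  simp only [map_sum, map_pow]
  exact Finset.sum_nonneg fun i _ => sq_nonneg _

theorem InPreT.eval_nonneg {r : ℕ} {f : MvPolynomial (Fin a × Fin b) ℝ}
    (hf : InPreT a b r μ ν f) {π : Fin a → Fin b → ℝ} (hπ : π ∈ transportPolytope a b μ ν) :
    0 ≤ eval (fun p => π p.1 p.2) f := by
  obtain ⟨σ₀, σ, l, t, h₀, -, hσ, -, -, rfl⟩ := hf
  have hrow : ∀ i, eval (fun p => π p.1 p.2) (rowPoly a b μ i) = 0 := fun i => by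
    simp [rowPoly, hπ.2.1]
  have hcol : ∀ j, eval (fun p => π p.1 p.2) (colPoly a b ν j) = 0 := fun j => by
    simp [colPoly, hπ.2.2]
  simp only [map_add, map_sum, map_mul, hrow, hcol, mul_zero, Finset.sum_const_zero, add_zero]
  refine add_nonneg (h₀.eval_nonneg _) (Finset.sum_nonneg fun I _ =>
    mul_nonneg ?_ ((hσ I).1.eval_nonneg _))
  simp only [eI, map_prod, eval_X]
  exact Finset.prod_nonneg fun p _ => hπ.1 _ _

theorem le_DGW_of_inPreT (hμ : IsProbVec μ) (hν : IsProbVec ν) {r : ℕ} {c : ℝ}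
    (h : InPreT a b r μ ν (Lpoly a b L - C c)) : c ≤ DGW a b μ ν L := by
  obtain ⟨ρ, hρ⟩ := transportPolytope_nonempty hμ hν
  refine le_csInf ⟨_, ρ, hρ, rfl⟩ ?_
  rintro _ ⟨π, hπ, rfl⟩
  simpa [Lpoly, Lquad] using h.eval_nonneg hπ

theorem DGW_le_Lquad_add_error (hμ : IsProbVec μ) (hν : IsProbVec ν) {δ : ℝ} (hδ : 0 ≤ δ)
    {z : Fin a → Fin b → ℝ} (hz : ∀ i j, -δ ≤ z i j) (hz2 : ∀ i j, |z i j| ≤ 2) :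
    DGW a b μ ν L ≤ Lquad a b L z + Kmax a b L * ((2 * (a * b) + 1) *
      (5 * (∑ i, |∑ j, z i j - μ i| + ∑ j, |∑ i, z i j - ν j|) + 11 * (a * b) * δ)) := by
  let y : Fin a → Fin b → ℝ := fun i j => max (z i j) 0
  have hzy : ∀ i j, |z i j - y i j| ≤ δ := fun i j => by
    have := hz i j
    change |z i j - max (z i j) 0| ≤ δ
    rcases max_cases (z i j) 0 with ⟨h, h'⟩ | ⟨h, h'⟩ <;> rw [h, abs_le] <;>
      constructor <;> linarith
  have hyz : ∀ i j, |y i j - z i j| ≤ δ := fun i j => by rw [abs_sub_comm]; exact hzy i j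
  obtain ⟨π, hπ, hy⟩ := exists_mem_transportPolytope_near hμ hν (z := y) fun i j => le_max_right _ _
  have hrow : ∑ i, |∑ j, y i j - μ i| ≤ ∑ i, |∑ j, z i j - μ i| + a * b * δ := by
    have : ∀ i, |∑ j, y i j - μ i| ≤ |∑ j, z i j - μ i| + b * δ := fun i => by
      have h1 : |∑ j, (y i j - z i j)| ≤ b * δ :=
        (Finset.abs_sum_le_sum_abs _ _).trans
          ((Finset.sum_le_sum fun j _ => hyz i j).trans (by simp))
      rw [Finset.sum_sub_distrib] at h1
      have := abs_add_le (∑ j, z i j - μ i) (∑ j, y i j - ∑ j, z i j)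
      rw [show ∑ j, z i j - μ i + (∑ j, y i j - ∑ j, z i j) = ∑ j, y i j - μ i by ring] at this
      linarith
    refine (Finset.sum_le_sum fun i _ => this i).trans ?_
    simp [Finset.sum_add_distrib, mul_assoc]
  have hcol : ∑ j, |∑ i, y i j - ν j| ≤ ∑ j, |∑ i, z i j - ν j| + a * b * δ := by
    have : ∀ j, |∑ i, y i j - ν j| ≤ |∑ i, z i j - ν j| + a * δ := fun j => by
      have h1 : |∑ i, (y i j - z i j)| ≤ a * δ :=
        (Finset.abs_sum_le_sum_abs _ _).trans
          ((Finset.sum_le_sum fun i _ => hyz i j).trans (by simp))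
      rw [Finset.sum_sub_distrib] at h1
      have := abs_add_le (∑ i, z i j - ν j) (∑ i, y i j - ∑ i, z i j)
      rw [show ∑ i, z i j - ν j + (∑ i, y i j - ∑ i, z i j) = ∑ i, y i j - ν j by ring] at this
      linarith
    refine (Finset.sum_le_sum fun j _ => this j).trans (le_of_eq ?_)
    simp only [Finset.sum_add_distrib, Finset.sum_const, Finset.card_univ, Fintype.card_fin,
      nsmul_eq_mul]
    ring
  have hdist : ∑ i, ∑ j, |z i j - π i j| ≤
      5 * (∑ i, |∑ j, z i j - μ i| + ∑ j, |∑ i, z i j - ν j|) + 11 * (a * b) * δ := by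
    have : ∑ i, ∑ j, |z i j - π i j| ≤ a * b * δ + ∑ i, ∑ j, |y i j - π i j| := by
      calc ∑ i, ∑ j, |z i j - π i j| ≤ ∑ i, ∑ j, (δ + |y i j - π i j|) :=
            Finset.sum_le_sum fun i _ => Finset.sum_le_sum fun j _ =>
              (abs_sub_le _ (y i j) _).trans (by linarith [hzy i j])
        _ = _ := by simp [Finset.sum_add_distrib, mul_assoc]
    linarith
  have hzsum : ∑ i, ∑ j, |z i j| ≤ 2 * (a * b) :=
    (Finset.sum_le_sum fun i _ => Finset.sum_le_sum fun j _ => hz2 i j).trans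
      (le_of_eq (by simp; ring))
  have hL := (abs_le.1 (abs_Lquad_sub_le L z π)).1
  rw [sum_sum_abs_eq_one hμ hπ] at hL
  have := mul_le_mul_of_nonneg_left (mul_le_mul (add_le_add_left hzsum 1) hdist
    (by positivity) (by positivity)) (Kmax_nonneg L)
  linarith [DGW_le_Lquad L hμ hπ]

theorem DGW_sub_le_Lquad_add_penalty (hμ : IsProbVec μ) (hν : IsProbVec ν) {δ : ℝ} (hδ : 0 ≤ δ)
    {z : Fin a → Fin b → ℝ} (hz : ∀ i j, -δ ≤ z i j) (hz2 : ∀ i j, |z i j| ≤ 2)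
    {r : ℝ} (hr : 0 < r) :
    DGW a b μ ν L - Kmax a b L * (11 * (2 * (a * b) + 1) * (a * b) * δ
        + (a + b) * (25 * (2 * (a * b) + 1) ^ 2 / (4 * r)))
      ≤ Lquad a b L z + Kmax a b L * r * marginalPenalty a b μ ν z := by
  set G : ℝ := 2 * (a * b) + 1
  have hq : ∀ t : ℝ, 5 * G * |t| ≤ r * t ^ 2 + 25 * G ^ 2 / (4 * r) := fun t => by
    have : r * t ^ 2 + 25 * G ^ 2 / (4 * r) - 5 * G * |t| = (2 * r * |t| - 5 * G) ^ 2 / (4 * r) := by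
      rw [← sq_abs t]
      field_simp
      ring
    have : 0 ≤ (2 * r * |t| - 5 * G) ^ 2 / (4 * r) := by positivity
    linarith
  have hrow : 5 * G * ∑ i, |∑ j, z i j - μ i|
      ≤ r * ∑ i, (∑ j, z i j - μ i) ^ 2 + a * (25 * G ^ 2 / (4 * r)) := by
    rw [Finset.mul_sum, Finset.mul_sum]
    refine (Finset.sum_le_sum fun i _ => hq _).trans (le_of_eq ?_)
    simp [Finset.sum_add_distrib]
  have hcol : 5 * G * ∑ j, |∑ i, z i j - ν j|
      ≤ r * ∑ j, (∑ i, z i j - ν j) ^ 2 + b * (25 * G ^ 2 / (4 * r)) := by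
    rw [Finset.mul_sum, Finset.mul_sum]
    refine (Finset.sum_le_sum fun i _ => hq _).trans (le_of_eq ?_)
    simp [Finset.sum_add_distrib]
  have h := DGW_le_Lquad_add_error L hμ hν hδ hz hz2
  have h' := mul_le_mul_of_nonneg_left (add_le_add hrow hcol) (Kmax_nonneg L)
  unfold marginalPenalty
  linarith

end Objective

theorem kernel_angle_bounds {D r : ℕ} (hD : 0 < D) (hr : 4 * D ≤ r) :
    1 / Real.cos (Real.pi / ((r / D : ℕ) + 1)) ≤ 2 ∧
    1 / Real.cos (Real.pi / ((r / D : ℕ) + 1)) ≤ 1 + 10 * D ^ 2 / (r : ℝ) ^ 2 ∧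
    Real.tan (Real.pi / ((r / D : ℕ) + 1)) ^ 2 / 4 ≤ 10 * D ^ 2 / (r : ℝ) ^ 2 := by
  have hD' : (0 : ℝ) < D := by exact_mod_cast hD
  have hr0 : (0 : ℝ) < r := by
    have : 0 < r := by omega
    exact_mod_cast this
  have hN : (4 : ℝ) ≤ (r / D : ℕ) := by
    exact_mod_cast (Nat.le_div_iff_mul_le hD).2 hr
  have hNr : (r : ℝ) / D ≤ (r / D : ℕ) + 1 := by
    rw [div_le_iff₀ hD', mul_comm]
    exact_mod_cast (Nat.lt_mul_div_succ r hD).le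
  set h : ℝ := Real.pi / ((r / D : ℕ) + 1) with hh
  have h0 : 0 < h := by positivity
  have h3 : h ≤ Real.pi / 3 := by
    rw [hh]; gcongr; linarith
  have hc : 1 / 2 ≤ Real.cos h := by
    rw [← Real.cos_pi_div_three]
    exact Real.cos_le_cos_of_nonneg_of_le_pi h0.le (by linarith [Real.pi_pos]) h3
  have hc0 : 0 < Real.cos h := by linarith
  have hsq : h ^ 2 ≤ 10 * D ^ 2 / (r : ℝ) ^ 2 := by
    have h1 : h ≤ Real.pi * (D / r) := by
      rw [hh, div_eq_mul_inv]
      refine mul_le_mul_of_nonneg_left ?_ Real.pi_pos.le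
      rw [← inv_div]
      exact inv_anti₀ (by positivity) hNr
    have hpi : Real.pi ^ 2 ≤ 10 := by nlinarith [Real.pi_lt_d2, Real.pi_pos]
    calc h ^ 2 ≤ (Real.pi * (D / r)) ^ 2 := by gcongr
      _ = Real.pi ^ 2 * (D ^ 2 / r ^ 2) := by ring
      _ ≤ 10 * (D ^ 2 / r ^ 2) := by gcongr
      _ = _ := by ring
  refine ⟨?_, ?_, ?_⟩
  · rw [div_le_iff₀ hc0]
    linarith
  · have : 1 / Real.cos h ≤ 1 + h ^ 2 := by
      rw [div_le_iff₀ hc0]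
      have := Real.one_sub_sq_div_two_le_cos (x := h)
      nlinarith [sq_nonneg h]
    linarith
  · have : Real.tan h ^ 2 ≤ 4 * h ^ 2 := by
      rw [Real.tan_eq_sin_div_cos, div_pow, div_le_iff₀ (by positivity)]
      have hc2 : 1 ≤ 4 * Real.cos h ^ 2 := by nlinarith
      nlinarith [Real.sin_sq_le_sq (x := h), mul_le_mul_of_nonneg_left hc2 (sq_nonneg h)]
    linarith

theorem DGW_sub_lbS_bounds {m n : ℕ} (hm : 0 < m) (hn : 0 < n) {μ : Fin m → ℝ} {ν : Fin n → ℝ}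
    (hμ : IsProbVec μ) (hν : IsProbVec ν) (L : Fin m → Fin n → Fin m → Fin n → ℝ) {r : ℕ}
    (hr : 4 * (m * n) ≤ r) :
    lbS m n r μ ν L ≤ DGW m n μ ν L ∧
    DGW m n μ ν L - Kmax m n L * (55 * (2 * (m * n) + 1) * (m * n) ^ 3
      + (m + n) * (25 * (2 * (m * n) + 1) ^ 2 / 4) + 30 * (m * n) ^ 3) / r ≤ lbS m n r μ ν L := by
  have hD : 0 < m * n := Nat.mul_pos hm hn
  have hr1 : (1 : ℝ) ≤ r := by
    have : 1 ≤ r := by omega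
    exact_mod_cast this
  have hr0 : (0 : ℝ) < r := by linarith
  set K := Kmax m n L
  have hK : 0 ≤ K := Kmax_nonneg L
  set c := DGW m n μ ν L - K * (55 * (2 * (m * n) + 1) * (m * n) ^ 3
      + (m + n) * (25 * (2 * (m * n) + 1) ^ 2 / 4) + 30 * (m * n) ^ 3) / r with hcdef
  obtain ⟨hq2, hq, hτ⟩ := kernel_angle_bounds hD hr
  set q := 1 / Real.cos (Real.pi / ((r / (m * n) : ℕ) + 1))
  set τ := Real.tan (Real.pi / ((r / (m * n) : ℕ) + 1)) ^ 2 / 4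
  push_cast at hq hτ
  have hKr : K ≤ K * r := le_mul_of_one_le_right hK hr1
  have hLK : ∀ i j, |L i j i j| ≤ K := fun i j => abs_le_Kmax L i j i j
  have hη : ∑ i, ∑ j, (L i j i j + 2 * (K * r)) * τ ≤ K * (30 * (m * n) ^ 3) / r := by
    have hterm : ∀ i j, (L i j i j + 2 * (K * r)) * τ ≤ 3 * (K * r) * (10 * (m * n) ^ 2 / r ^ 2) :=
      fun i j => mul_le_mul (by linarith [(abs_le.1 (hLK i j)).2]) hτ (by positivity)
        (by positivity)
    refine (Finset.sum_le_sum fun i _ => Finset.sum_le_sum fun j _ => hterm i j).trans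
      (le_of_eq ?_)
    simp only [Finset.sum_const, Finset.card_univ, Fintype.card_fin, nsmul_eq_mul]
    field_simp
    ring
  have hmem : InPreT m n r μ ν (Lpoly m n L - C c) := by
    refine inPreT_of_mem_preorderCone (Lpoly_sub_C_mem_preorderCone (N := r / (m * n))
      (M := K * r) hμ.2 L ?_ ?_ (by omega) (fun i j => ?_) fun z hz => ?_)
    · exact (by norm_num : 2 ≤ 4).trans ((Nat.le_div_iff_mul_le hD).2 hr)
    · have := Nat.mul_div_le r (m * n)
      nlinarith
    · linarith [(abs_le.1 (hLK i j)).1]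
    · have h := DGW_sub_le_Lquad_add_penalty L hμ hν (δ := 5 * (m * n) ^ 2 / r ^ 2) (by positivity)
        (z := z) (fun i j => ?_) (fun i j => ?_) hr0
      · have hpow : (5 * (m * n) ^ 2 / r ^ 2 : ℝ) ≤ 5 * (m * n) ^ 2 / r := by
          gcongr
          nlinarith
        have h' : K * (11 * (2 * (m * n) + 1) * (m * n) * (5 * (m * n) ^ 2 / r ^ 2))
            ≤ K * (11 * (2 * (m * n) + 1) * (m * n) * (5 * (m * n) ^ 2 / r)) := by
          gcongr
        have hsplit : c = DGW m n μ ν L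
            - K * (11 * (2 * (m * n) + 1) * (m * n) * (5 * (m * n) ^ 2 / r))
            - K * ((m + n) * (25 * (2 * (m * n) + 1) ^ 2 / (4 * r)))
            - K * (30 * (m * n) ^ 3) / r := by
          rw [hcdef]
          field_simp
          ring
        linarith
      · have := (abs_le.1 (hz i j)).1
        have h5 : (5 * (m * n) ^ 2 / r ^ 2 : ℝ) = 10 * (m * n) ^ 2 / r ^ 2 / 2 := by ring
        rw [h5]
        linarith
      · have := abs_le.1 (hz i j)
        exact abs_le.2 ⟨by linarith, by linarith⟩
  exact ⟨csSup_le ⟨c, hmem⟩ fun _ => le_DGW_of_inPreT L hμ hν,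
    le_csSup ⟨_, fun _ => le_DGW_of_inPreT L hμ hν⟩ hmem⟩

/-- Convergence rate of the Schmüdgen SOS hierarchy for the discrete
Gromov-Wasserstein problem. -/
theorem stmt7 (m n : ℕ) (hm : 0 < m) (hn : 0 < n) :
    ∃ B : ℝ, 0 < B ∧ ∃ C : ℝ, 0 < C ∧
      ∀ (μ : Fin m → ℝ) (ν : Fin n → ℝ), IsProbVec μ → IsProbVec ν →
        ∀ (L : Fin m → Fin n → Fin m → Fin n → ℝ) (r : ℕ), 4 * (m * n) ≤ r →
          0 ≤ DGW m n μ ν L - lbS m n r μ ν L ∧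
          DGW m n μ ν L - lbS m n r μ ν L ≤
            (C / (r : ℝ) ^ 2) *
                (Kmax m n L - DGW m n μ ν L
                  + 3 * Real.sqrt ((m : ℝ) * n) * Kmax m n L * B)
              + (Real.sqrt C / (r : ℝ)) * (3 * Real.sqrt ((m : ℝ) * n) * Kmax m n L * B) := by
  refine ⟨55 * (2 * (m * n) + 1) * (m * n) ^ 3 + (m + n) * (25 * (2 * (m * n) + 1) ^ 2 / 4)
    + 30 * (m * n) ^ 3, by positivity, 1, one_pos, fun μ ν hμ hν L r hr => ?_⟩
  obtain ⟨hle, hge⟩ := DGW_sub_lbS_bounds hm hn hμ hν L hr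
  set B : ℝ := 55 * (2 * (m * n) + 1) * (m * n) ^ 3 + (m + n) * (25 * (2 * (m * n) + 1) ^ 2 / 4)
    + 30 * (m * n) ^ 3
  have hB : 0 ≤ B := by positivity
  have hK := Kmax_nonneg L
  have hDK := sub_nonneg.2 (DGW_le_Kmax L hμ hν)
  have hmn : 1 ≤ Real.sqrt ((m : ℝ) * n) := by
    rw [Real.one_le_sqrt]
    exact_mod_cast Nat.mul_pos hm hn
  refine ⟨sub_nonneg.2 hle, ?_⟩
  have h1 : Kmax m n L * B ≤ 3 * Real.sqrt ((m : ℝ) * n) * Kmax m n L * B := by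
    rw [mul_assoc (3 * _)]
    exact le_mul_of_one_le_left (by positivity) (by linarith)
  have h2 : Kmax m n L * B / r
      ≤ Real.sqrt 1 / (r : ℝ) * (3 * Real.sqrt ((m : ℝ) * n) * Kmax m n L * B) := by
    rw [Real.sqrt_one, one_div_mul_eq_div]
    gcongr
  have h3 : 0 ≤ 1 / (r : ℝ) ^ 2 * (Kmax m n L - DGW m n μ ν L
      + 3 * Real.sqrt ((m : ℝ) * n) * Kmax m n L * B) := by positivity
  linarith
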